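/- arXiv:2309.00467 — 2 statements merged into one kernel-verified Lean document; each statement's English description precedes it below -/
import Mathlib

section
/- Let u,v ∈ S_n have separated descents at position k, and let w ∈ S_n. Then the double Schubert structure constant c̄_{u,v}^w(t,y) equals Σ_{π∈PP_0(u,v,w)} wt_0(π), the sum over all Schubert pipe puzzles for (u,v,w) of their Schubert weights. -/
open MvPolynomial

noncomputable section

namespace BPDPuzzle

/-- `x ⊖ y = (x - y)/(1 + β·y)`. -/
def ominus {K : Type*} [Field K] (β a b : K) : K := (a - b) / (1 + β * b)

/-- A permutation of `ℕ` lying in `S_∞`, i.e. fixing all sufficiently large integers. -/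
def FinPerm (w : Equiv.Perm ℕ) : Prop := ∃ N : ℕ, ∀ j, N ≤ j → w j = j

/-- A permutation of `ℕ` lying in `S_n` (0-based positions `0, …, n-1`). -/
def InSn (n : ℕ) (w : Equiv.Perm ℕ) : Prop := ∀ j, n ≤ j → w j = j

/-- Coxeter length: the number of inversions. -/
def len (w : Equiv.Perm ℕ) : ℕ := Set.ncard {p : ℕ × ℕ | p.1 < p.2 ∧ w p.2 < w p.1}

/-- The simple transposition `s_i`, exchanging the (0-based) positions `i` and `i+1`. -/
def sTr (i : ℕ) : Equiv.Perm ℕ := Equiv.swap i (i + 1)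

/-- `u` and `v` have separated descents at position `k`, i.e.
`maxdes(u) ≤ k ≤ mindes(v)` (in 0-based conventions: `u` has no descent at any
0-based position `≥ k` and `v` has no descent at any 0-based position `< k-1`). -/
def SepDesc (k : ℕ) (u v : Equiv.Perm ℕ) : Prop :=
  (∀ i, k ≤ i → u i ≤ u (i + 1)) ∧ (∀ i, i + 1 < k → v i ≤ v (i + 1))

/-- The longest element `n ⋯ 2 1` of `S_n`, extended by the identity. -/
def revPerm (n : ℕ) : Equiv.Perm ℕ where
  toFun j := if j < n then n - 1 - j else j
  invFun j := if j < n then n - 1 - j else j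
  left_inv j := by dsimp only; split_ifs <;> omega
  right_inv j := by dsimp only; split_ifs <;> omega

/-- Exchange the values of a valuation at the indices `i` and `i+1`. -/
def swapVal {K : Type*} (t : ℕ → K) (i : ℕ) : ℕ → K :=
  fun j => if j = i then t (i + 1) else if j = i + 1 then t i else t j

/-- The defining properties of the family of double Grothendieck polynomials
`𝔊_w(x, t)`, viewed as a family of polynomials in the `x`-variables depending on
a valuation `t` of the second set of variables:  the initial condition
`𝔊_{n⋯21}(x,t) = ∏_{i+j≤n} (x_i ⊖ t_j)` together with the Demazure recursion
`π_i 𝔊_w = 𝔊_{w s_i}` whenever `w(i) > w(i+1)` (the latter written with the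
denominator `x_i - x_{i+1}` cleared). -/
def GrothFamily {K : Type*} [Field K] (β : K)
    (G : (ℕ → K) → Equiv.Perm ℕ → MvPolynomial ℕ K) : Prop :=
  ∀ t : ℕ → K, (∀ j, 1 + β * t j ≠ 0) →
    (∀ n : ℕ, G t (revPerm n) =
      ∏ i ∈ Finset.range n, ∏ j ∈ Finset.range (n - 1 - i),
        C ((1 + β * t j)⁻¹) * (X i - C (t j))) ∧
    (∀ (w : Equiv.Perm ℕ) (i : ℕ), w (i + 1) < w i →
      (X i - X (i + 1)) * G t (w * sTr i) =
        (1 + C β * X (i + 1)) * G t w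
          - (1 + C β * X i) * rename ⇑(Equiv.swap i (i + 1)) (G t w))

/-- The defining property of the structure constants `c_{u,v}^w(t,y)`:
`𝔊_u(x,y) · 𝔊_v(x,t) = Σ_w c_{u,v}^w(t,y) · 𝔊_w(x,t)`, the (finitely supported)
sum ranging over the permutations `w ∈ S_∞`. -/
def StructConsts {K : Type*} [Field K] (β : K)
    (G : (ℕ → K) → Equiv.Perm ℕ → MvPolynomial ℕ K)
    (c : (ℕ → K) → (ℕ → K) → Equiv.Perm ℕ → Equiv.Perm ℕ → Equiv.Perm ℕ → K) : Prop :=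
  ∀ t y : ℕ → K, (∀ j, 1 + β * t j ≠ 0) → (∀ j, 1 + β * y j ≠ 0) →
    ∀ u v : Equiv.Perm ℕ, FinPerm u → FinPerm v →
      {w : Equiv.Perm ℕ | c t y u v w ≠ 0}.Finite ∧
      (∀ w, ¬ FinPerm w → c t y u v w = 0) ∧
      G y u * G t v = ∑ᶠ w : Equiv.Perm ℕ, C (c t y u v w) * G t w

/-! ### The lattice model / pipe puzzles -/

/-- A state of the `n × n` lattice model: labels in `{0, …, n}` on all horizontal
and vertical (half-)edges.  `sst.1 i j` is the `j`-th horizontal (half-)edge of row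
`i` (`j = 0` being the left boundary and `j = n` the right boundary), and
`sst.2 i j` is the `i`-th vertical (half-)edge of column `j` (`i = 0` the top
boundary, `i = n` the bottom boundary). -/
abbrev GridState (n : ℕ) : Type :=
  (Fin n → Fin (n + 1) → Fin (n + 1)) × (Fin (n + 1) → Fin n → Fin (n + 1))

/-- The label on the north edge of the tile in row `i`, column `j`. -/
def labN {n : ℕ} (sst : GridState n) (i j : Fin n) : ℕ := (sst.2 i.castSucc j : ℕ)
/-- The label on the east edge of the tile in row `i`, column `j`. -/
def labE {n : ℕ} (sst : GridState n) (i j : Fin n) : ℕ := (sst.1 i j.succ : ℕ)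
/-- The label on the west edge of the tile in row `i`, column `j`. -/
def labW {n : ℕ} (sst : GridState n) (i j : Fin n) : ℕ := (sst.1 i j.castSucc : ℕ)
/-- The label on the south edge of the tile in row `i`, column `j`. -/
def labS {n : ℕ} (sst : GridState n) (i j : Fin n) : ℕ := (sst.2 i.succ j : ℕ)

/-- Boundary label `κ_u` on the right side (0-based row `i`, 1-based pipe labels). -/
def kappaLab (k : ℕ) (u : Equiv.Perm ℕ) (i : ℕ) : ℕ :=
  if u⁻¹ i < k then u⁻¹ i + 1 else 0

/-- Boundary label `θ_v` on the top side (0-based column `j`, 1-based pipe labels). -/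
def thetaLab (k : ℕ) (v : Equiv.Perm ℕ) (j : ℕ) : ℕ :=
  if k ≤ v⁻¹ j then v⁻¹ j + 1 else 0

/-- Boundary label `η_w` on the bottom side (0-based column `j`, 1-based pipe labels). -/
def etaLab (w : Equiv.Perm ℕ) (j : ℕ) : ℕ := w⁻¹ j + 1

/-- The boundary condition for pipe puzzles for `(u, v, w)`: left edges all `0`,
right edges `κ_u`, top edges `θ_v`, bottom edges `η_w`. -/
def BoundaryCond (n k : ℕ) (u v w : Equiv.Perm ℕ) (sst : GridState n) : Prop :=
  (∀ i : Fin n, (sst.1 i 0 : ℕ) = 0) ∧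
  (∀ i : Fin n, (sst.1 i (Fin.last n) : ℕ) = kappaLab k u (i : ℕ)) ∧
  (∀ j : Fin n, (sst.2 0 j : ℕ) = thetaLab k v (j : ℕ)) ∧
  (∀ j : Fin n, (sst.2 (Fin.last n) j : ℕ) = etaLab w (j : ℕ))

/-- The admissible local configurations (tiles) of a pipe puzzle, in terms of the
four edge labels `N, E, W, S` around a tile:  the empty tile, the vertical pipe,
the horizontal pipe, the crossing (with the horizontal pipe carrying the smaller
label), the two elbows `⌟` and `⌐` (labels `≤ k` coming from the right side,
labels `> k` from the top side), and the bumping tiles (with the stated label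
restrictions). -/
def LAdm (k N E W S : ℕ) : Prop :=
  (N = 0 ∧ E = 0 ∧ W = 0 ∧ S = 0) ∨
  (E = 0 ∧ W = 0 ∧ 0 < N ∧ N = S) ∨
  (N = 0 ∧ S = 0 ∧ 0 < E ∧ E = W) ∨
  (0 < E ∧ E = W ∧ E < N ∧ N = S) ∨
  (E = 0 ∧ S = 0 ∧ 0 < N ∧ N = W ∧ N ≤ k) ∨
  (E = 0 ∧ S = 0 ∧ N = W ∧ k < N) ∨
  (N = 0 ∧ W = 0 ∧ 0 < E ∧ E = S ∧ E ≤ k) ∨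
  (N = 0 ∧ W = 0 ∧ E = S ∧ k < E) ∨
  (0 < E ∧ E = S ∧ E < N ∧ N = W ∧ N ≤ k) ∨
  (k < E ∧ E = S ∧ E < N ∧ N = W) ∨
  (0 < N ∧ N = W ∧ N ≤ k ∧ E = S ∧ k < E)

/-- The admissible local configurations of a Schubert pipe puzzle (no bumping
tiles; crossings have the horizontal pipe carrying the smaller label). -/
def LAdm0 (N E W S : ℕ) : Prop :=
  (N = 0 ∧ E = 0 ∧ W = 0 ∧ S = 0) ∨
  (E = 0 ∧ W = 0 ∧ 0 < N ∧ N = S) ∨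
  (N = 0 ∧ S = 0 ∧ 0 < E ∧ E = W) ∨
  (0 < E ∧ E = W ∧ E < N ∧ N = S) ∨
  (E = 0 ∧ S = 0 ∧ 0 < N ∧ N = W) ∨
  (N = 0 ∧ W = 0 ∧ 0 < E ∧ E = S)

/-- The vertex weight `L(x; N, E, W, S)` of the lattice model (equivalently, the
weight of the corresponding pipe-puzzle tile), with spectral parameter `x`. -/
def Lwt {K : Type*} [Field K] (β : K) (k : ℕ) (x : K) (N E W S : ℕ) : K :=
  if N = 0 ∧ E = 0 ∧ W = 0 ∧ S = 0 then x
  else if E = 0 ∧ W = 0 ∧ 0 < N ∧ N = S then 1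
  else if N = 0 ∧ S = 0 ∧ 0 < E ∧ E = W then 1
  else if 0 < E ∧ E = W ∧ E < N ∧ N = S then 1
  else if E = 0 ∧ S = 0 ∧ 0 < N ∧ N = W ∧ N ≤ k then 1 + β * x
  else if E = 0 ∧ S = 0 ∧ N = W ∧ k < N then 1
  else if N = 0 ∧ W = 0 ∧ 0 < E ∧ E = S ∧ E ≤ k then 1
  else if N = 0 ∧ W = 0 ∧ E = S ∧ k < E then 1 + β * x
  else if 0 < E ∧ E = S ∧ E < N ∧ N = W ∧ N ≤ k then β
  else if k < E ∧ E = S ∧ E < N ∧ N = W then β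
  else if 0 < N ∧ N = W ∧ N ≤ k ∧ E = S ∧ k < E then β * (1 + β * x)
  else 0

/-- The set of pipe puzzles for `(u, v, w)` (with separated-descent parameter `k`),
encoded as admissible states of the lattice model. -/
def PP (n k : ℕ) (u v w : Equiv.Perm ℕ) : Set (GridState n) :=
  {sst | BoundaryCond n k u v w sst ∧
    ∀ i j : Fin n, LAdm k (labN sst i j) (labE sst i j) (labW sst i j) (labS sst i j)}

/-- The set of Schubert pipe puzzles for `(u, v, w)`. -/
def PP0 (n k : ℕ) (u v w : Equiv.Perm ℕ) : Set (GridState n) :=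
  {sst | BoundaryCond n k u v w sst ∧
    ∀ i j : Fin n, LAdm0 (labN sst i j) (labE sst i j) (labW sst i j) (labS sst i j)}

/-- The weight `wt(π)` of a pipe puzzle: the product over all tiles, the tile in
row `i` and column `j` having spectral parameter `t_j ⊖ y_i`. -/
def stateWt {K : Type*} [Field K] (β : K) (k : ℕ) (t y : ℕ → K) {n : ℕ}
    (sst : GridState n) : K :=
  ∏ i : Fin n, ∏ j : Fin n,
    Lwt β k (ominus β (t (j : ℕ)) (y (i : ℕ)))
      (labN sst i j) (labE sst i j) (labW sst i j) (labS sst i j)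

/-- The Schubert weight `wt₀(π)`: the product of `t_j - y_i` over the positions
`(i, j)` of the empty tiles. -/
def stateWt0 {K : Type*} [Field K] (t y : ℕ → K) {n : ℕ} (sst : GridState n) : K :=
  ∏ i : Fin n, ∏ j : Fin n,
    if labN sst i j = 0 ∧ labE sst i j = 0 ∧ labW sst i j = 0 ∧ labS sst i j = 0
    then t (j : ℕ) - y (i : ℕ) else 1

/-! ### Divided differences -/

section DividedDifference

variable {K : Type*} [Field K]

/-- The action of the simple transposition `s_i` on polynomials. -/
abbrev sAct (i : ℕ) : MvPolynomial ℕ K →ₐ[K] MvPolynomial ℕ K :=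
  rename (Equiv.swap i (i + 1))

lemma X_sub_X_succ_ne_zero (i : ℕ) : (X i - X (i + 1) : MvPolynomial ℕ K) ≠ 0 := by
  rw [sub_ne_zero]
  intro h
  exact absurd (X_injective h) (by omega)

lemma exists_mul_eq_sub_sAct (i : ℕ) (f : MvPolynomial ℕ K) :
    ∃ g, (X i - X (i + 1)) * g = f - sAct i f := by
  induction f using MvPolynomial.induction_on with
  | C a => exact ⟨0, by simp⟩
  | add p q hp hq =>
    obtain ⟨g, hg⟩ := hp
    obtain ⟨h, hh⟩ := hq
    exact ⟨g + h, by rw [mul_add, hg, hh, map_add]; ring⟩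
  | mul_X p j hp =>
    obtain ⟨g, hg⟩ := hp
    rw [map_mul]
    simp only [rename_X]
    rcases eq_or_ne j i with rfl | hji
    · refine ⟨g * X (j + 1) + p, ?_⟩
      rw [Equiv.swap_apply_left]
      linear_combination X (j + 1) * hg
    rcases eq_or_ne j (i + 1) with rfl | hji'
    · refine ⟨g * X i - p, ?_⟩
      rw [Equiv.swap_apply_right]
      linear_combination X i * hg
    · refine ⟨g * X j, ?_⟩
      rw [Equiv.swap_apply_of_ne_of_ne hji hji']
      linear_combination X j * hg

/-- The divided difference operator `∂_i`. -/
def dd (i : ℕ) : MvPolynomial ℕ K →ₗ[K] MvPolynomial ℕ K where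
  toFun f := (exists_mul_eq_sub_sAct i f).choose
  map_add' f g := by
    refine mul_left_cancel₀ (X_sub_X_succ_ne_zero i) ?_
    rw [mul_add, (exists_mul_eq_sub_sAct i _).choose_spec,
      (exists_mul_eq_sub_sAct i _).choose_spec, (exists_mul_eq_sub_sAct i _).choose_spec, map_add]
    ring
  map_smul' c f := by
    refine mul_left_cancel₀ (X_sub_X_succ_ne_zero i) ?_
    rw [RingHom.id_apply, mul_smul_comm, (exists_mul_eq_sub_sAct i _).choose_spec,
      (exists_mul_eq_sub_sAct i _).choose_spec, map_smul, smul_sub]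

lemma dd_spec (i : ℕ) (f : MvPolynomial ℕ K) :
    (X i - X (i + 1)) * dd i f = f - sAct i f :=
  (exists_mul_eq_sub_sAct i f).choose_spec

lemma dd_eq_of_mul_eq {i : ℕ} {f g : MvPolynomial ℕ K}
    (h : (X i - X (i + 1)) * g = f - sAct i f) : dd i f = g :=
  mul_left_cancel₀ (X_sub_X_succ_ne_zero i) ((dd_spec i f).trans h.symm)

lemma sAct_sAct (i : ℕ) (f : MvPolynomial ℕ K) : sAct i (sAct i f) = f := by
  rw [rename_rename]
  convert rename_id_apply f
  ext j
  simp

lemma dd_eq_zero_iff {i : ℕ} {f : MvPolynomial ℕ K} : dd i f = 0 ↔ sAct i f = f := by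
  refine ⟨fun h => ?_, fun h => dd_eq_of_mul_eq (by simp [h])⟩
  have := dd_spec i f
  rw [h, mul_zero] at this
  exact (sub_eq_zero.1 this.symm).symm

lemma sAct_dd (i : ℕ) (f : MvPolynomial ℕ K) : sAct i (dd i f) = dd i f := by
  refine (dd_eq_of_mul_eq ?_).symm
  have := congrArg (sAct i) (dd_spec i f)
  simp only [map_mul, map_sub, sAct_sAct] at this
  simp only [rename_X, Equiv.swap_apply_left, Equiv.swap_apply_right] at this
  linear_combination -this

lemma dd_dd (i : ℕ) (f : MvPolynomial ℕ K) : dd i (dd i f) = 0 :=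
  dd_eq_zero_iff.2 (sAct_dd i f)

lemma dd_mul (i : ℕ) (f g : MvPolynomial ℕ K) :
    dd i (f * g) = dd i f * g + sAct i f * dd i g := by
  refine dd_eq_of_mul_eq ?_
  rw [map_mul]
  linear_combination g * dd_spec i f + sAct i f * dd_spec i g

lemma dd_mul_of_dd_left_eq_zero {i : ℕ} {f : MvPolynomial ℕ K} (g : MvPolynomial ℕ K)
    (h : dd i f = 0) : dd i (f * g) = f * dd i g := by
  rw [dd_mul, h, dd_eq_zero_iff.1 h, zero_mul, zero_add]

lemma sAct_comm {i j : ℕ} (h : i + 2 ≤ j) (f : MvPolynomial ℕ K) :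
    sAct i (sAct j f) = sAct j (sAct i f) := by
  rw [rename_rename, rename_rename]
  congr 1
  congr 1
  ext a
  simp only [Function.comp_apply, Equiv.swap_apply_def]
  split_ifs <;> omega

lemma sAct_braid (i : ℕ) (f : MvPolynomial ℕ K) :
    sAct i (sAct (i + 1) (sAct i f)) = sAct (i + 1) (sAct i (sAct (i + 1) f)) := by
  simp only [rename_rename]
  congr 1
  congr 1
  ext a
  simp only [Function.comp_apply, Equiv.swap_apply_def]
  split_ifs <;> omega

lemma dd_comm {i j : ℕ} (h : i + 2 ≤ j) (f : MvPolynomial ℕ K) :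
    dd i (dd j f) = dd j (dd i f) := by
  have hXi : sAct i (X j - X (j + 1) : MvPolynomial ℕ K) = X j - X (j + 1) := by
    simp only [map_sub, rename_X]
    rw [Equiv.swap_apply_of_ne_of_ne (by omega) (by omega),
      Equiv.swap_apply_of_ne_of_ne (by omega) (by omega)]
  have hXj : sAct j (X i - X (i + 1) : MvPolynomial ℕ K) = X i - X (i + 1) := by
    simp only [map_sub, rename_X]
    rw [Equiv.swap_apply_of_ne_of_ne (by omega) (by omega),
      Equiv.swap_apply_of_ne_of_ne (by omega) (by omega)]
  refine mul_left_cancel₀ (X_sub_X_succ_ne_zero i) (mul_left_cancel₀ (X_sub_X_succ_ne_zero j) ?_)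
  have h1 := congrArg (sAct i) (dd_spec j f)
  have h2 := congrArg (sAct j) (dd_spec i f)
  rw [map_mul, hXi, map_sub, sAct_comm h] at h1
  rw [map_mul, hXj, map_sub] at h2
  linear_combination (X j - X (j + 1)) * dd_spec i (dd j f) - (X i - X (i + 1)) * dd_spec j (dd i f)
    + dd_spec j f - dd_spec i f - h1 + h2

/-- The common denominator of the length-three divided difference. -/
lemma vandermonde_mul_dd_dd_dd (i j : ℕ) (a b c : MvPolynomial ℕ K) (f : MvPolynomial ℕ K)
    (hi : ∀ g, (a - b) * dd i g = g - sAct i g) (hj : ∀ g, (b - c) * dd j g = g - sAct j g)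
    (hia : sAct i a = b) (hib : sAct i b = a) (hic : sAct i c = c)
    (hja : sAct j a = a) (hjb : sAct j b = c) :
    (a - b) * (b - c) * (a - c) * dd i (dd j (dd i f)) =
      f - sAct i f - sAct j f + sAct i (sAct j f) + sAct j (sAct i f)
        - sAct i (sAct j (sAct i f)) := by
  have h1 := hi f
  have h1j := congrArg (sAct j) h1
  have h1ij := congrArg (sAct i) h1j
  have h2 := hj (dd i f)
  have h2i := congrArg (sAct i) h2
  have h3 := hi (dd j (dd i f))
  have e : sAct i (dd i f) = dd i f := sAct_dd i f
  simp only [map_mul, map_sub, hia, hib, hic, hja, hjb, e] at h1j h1ij h2i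
  linear_combination (b - c) * (a - c) * h3 + (a - c) * h2 - (b - c) * h2i + h1 - h1j + h1ij

lemma dd_braid (i : ℕ) (f : MvPolynomial ℕ K) :
    dd i (dd (i + 1) (dd i f)) = dd (i + 1) (dd i (dd (i + 1) f)) := by
  have s : ∀ j l : ℕ, sAct j (X l : MvPolynomial ℕ K) = X (Equiv.swap j (j + 1) l) :=
    fun j l => rename_X _ _
  have h1 := vandermonde_mul_dd_dd_dd i (i + 1) (X i) (X (i + 1)) (X (i + 2)) f
    (dd_spec i) (dd_spec (i + 1)) (by simp [s]) (by simp [s])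
    (by rw [s, Equiv.swap_apply_of_ne_of_ne] <;> omega)
    (by rw [s, Equiv.swap_apply_of_ne_of_ne] <;> omega) (by simp [s])
  have h2 := vandermonde_mul_dd_dd_dd (i + 1) i (-X (i + 2)) (-X (i + 1)) (-X i) f
    (fun g => by rw [← dd_spec]; ring) (fun g => by rw [← dd_spec]; ring)
    (by rw [map_neg]; simp [s]) (by rw [map_neg]; simp [s])
    (by rw [map_neg, s, Equiv.swap_apply_of_ne_of_ne] <;> omega)
    (by rw [map_neg, s, Equiv.swap_apply_of_ne_of_ne] <;> omega)
    (by rw [map_neg]; simp [s])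
  have h3 : (X i - X (i + 2) : MvPolynomial ℕ K) ≠ 0 := by
    rw [sub_ne_zero]
    intro h
    exact absurd (X_injective h) (by omega)
  refine mul_left_cancel₀ (mul_ne_zero (mul_ne_zero (X_sub_X_succ_ne_zero i)
    (X_sub_X_succ_ne_zero (i + 1))) h3) ?_
  have h4 := sAct_braid i f
  linear_combination h1 - h2 - h4

lemma dd_X_sub_C (i : ℕ) (y : K) : dd i (X i - C y) = 1 := by
  refine dd_eq_of_mul_eq ?_
  rw [map_sub, rename_X, algHom_C]
  simp

end DividedDifference

/-! ### Permutations of `ℕ` -/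

section Permutations

lemma sTr_apply (i a : ℕ) : sTr i a = if a = i then i + 1 else if a = i + 1 then i else a :=
  Equiv.swap_apply_def _ _ _

lemma sTr_inv (i : ℕ) : (sTr i)⁻¹ = sTr i := Equiv.swap_inv _ _

lemma sTr_mul_self (i : ℕ) : sTr i * sTr i = 1 := Equiv.swap_mul_self _ _

lemma sTr_left (i : ℕ) : sTr i i = i + 1 := Equiv.swap_apply_left _ _

lemma sTr_right (i : ℕ) : sTr i (i + 1) = i := Equiv.swap_apply_right _ _

lemma sTr_of_ne {i a : ℕ} (h : a ≠ i) (h' : a ≠ i + 1) : sTr i a = a :=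
  Equiv.swap_apply_of_ne_of_ne h h'

lemma perm_inv_apply_self (w : Equiv.Perm ℕ) (a : ℕ) : w⁻¹ (w a) = a := w.symm_apply_apply a

lemma perm_apply_inv_self (w : Equiv.Perm ℕ) (a : ℕ) : w (w⁻¹ a) = a := w.apply_symm_apply a

lemma sTr_sTr_apply (i a : ℕ) : sTr i (sTr i a) = a := by
  rw [← Equiv.Perm.mul_apply, sTr_mul_self, Equiv.Perm.one_apply]

lemma sTr_mul_cancel (i : ℕ) (w : Equiv.Perm ℕ) : sTr i * (sTr i * w) = w := by
  rw [← mul_assoc, sTr_mul_self, one_mul]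

lemma mul_sTr_cancel (i : ℕ) (w : Equiv.Perm ℕ) : w * sTr i * sTr i = w := by
  rw [mul_assoc, sTr_mul_self, mul_one]

lemma sTr_apply_add_two (i : ℕ) : sTr i (i + 1 + 1) = i + 1 + 1 :=
  sTr_of_ne (by omega) (by omega)

lemma sTr_succ_apply (i : ℕ) : sTr (i + 1) i = i := sTr_of_ne (by omega) (by omega)

lemma sTr_mul_sTr_mul_comm {i j : ℕ} (h : i + 2 ≤ j ∨ j + 2 ≤ i) (w : Equiv.Perm ℕ) :
    sTr i * (sTr j * w) = sTr j * (sTr i * w) := by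
  ext a
  simp only [Equiv.Perm.mul_apply, sTr_apply]
  split_ifs <;> omega

lemma sTr_mul_braid (i : ℕ) (w : Equiv.Perm ℕ) :
    sTr i * (sTr (i + 1) * (sTr i * w)) = sTr (i + 1) * (sTr i * (sTr (i + 1) * w)) := by
  ext a
  simp only [Equiv.Perm.mul_apply, sTr_apply]
  split_ifs <;> omega

lemma inv_sTr_mul_apply (i : ℕ) (w : Equiv.Perm ℕ) (a : ℕ) :
    (sTr i * w)⁻¹ a = w⁻¹ (sTr i a) := by
  rw [mul_inv_rev, sTr_inv, Equiv.Perm.mul_apply]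

lemma inv_mul_sTr_apply (i : ℕ) (w : Equiv.Perm ℕ) (a : ℕ) :
    (w * sTr i)⁻¹ a = sTr i (w⁻¹ a) := by
  rw [mul_inv_rev, sTr_inv, Equiv.Perm.mul_apply]

lemma InSn.lt_iff {n : ℕ} {w : Equiv.Perm ℕ} (h : InSn n w) {j : ℕ} : w j < n ↔ j < n := by
  constructor
  · intro h1
    by_contra h2
    rw [h j (by omega)] at h1
    omega
  · intro h1
    by_contra h2
    have := w.injective (h (w j) (by omega))
    omega

lemma InSn.inv {n : ℕ} {w : Equiv.Perm ℕ} (h : InSn n w) : InSn n w⁻¹ := fun j hj => by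
  rw [Equiv.Perm.inv_eq_iff_eq, h j hj]

lemma InSn.mul {n : ℕ} {v w : Equiv.Perm ℕ} (hv : InSn n v) (hw : InSn n w) :
    InSn n (v * w) := fun j hj => by
  rw [Equiv.Perm.mul_apply, hw j hj, hv j hj]

lemma InSn.mono {m n : ℕ} (hmn : m ≤ n) {w : Equiv.Perm ℕ} (h : InSn m w) : InSn n w :=
  fun j hj => h j (hmn.trans hj)

lemma inSn_sTr {n i : ℕ} (h : i + 1 < n) : InSn n (sTr i) := fun j hj => by
  rw [sTr_apply]
  split_ifs <;> omega

lemma inSn_one (n : ℕ) : InSn n 1 := fun _ _ => rfl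

lemma inSn_revPerm (n : ℕ) : InSn n (revPerm n) := fun j hj => by
  simp [revPerm, Nat.not_lt.2 hj]

lemma InSn.finPerm {n : ℕ} {w : Equiv.Perm ℕ} (h : InSn n w) : FinPerm w := ⟨n, h⟩

lemma FinPerm.mul {v w : Equiv.Perm ℕ} : FinPerm v → FinPerm w → FinPerm (v * w) := by
  rintro ⟨m, hm⟩ ⟨n, hn⟩
  exact ⟨max m n, InSn.mul (InSn.mono (le_max_left m n) hm) (InSn.mono (le_max_right m n) hn)⟩

lemma finPerm_sTr (i : ℕ) : FinPerm (sTr i) := (inSn_sTr (Nat.lt_succ_self (i + 1))).finPerm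

lemma finPerm_one : FinPerm 1 := ⟨0, fun _ _ => rfl⟩

lemma InSn.lt_of_descent {n i : ℕ} {w : Equiv.Perm ℕ} (h : InSn n w) (hi : w (i + 1) < w i) :
    i + 1 < n := by
  by_contra h'
  rcases Nat.lt_or_ge i n with h1 | h1
  · have h2 := h (i + 1) (by omega)
    have h3 := h.lt_iff.2 h1
    omega
  · rw [h i h1, h (i + 1) (by omega)] at hi
    omega

lemma perm_apply_ne_succ (w : Equiv.Perm ℕ) (i : ℕ) : w i ≠ w (i + 1) :=
  w.injective.ne (by omega)

lemma perm_eq_one_of_forall_lt {w : Equiv.Perm ℕ} (h : ∀ i, w i < w (i + 1)) : w = 1 := by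
  have h1 : StrictMono w := strictMono_nat_of_lt_succ h
  have h2 : StrictMono ⇑w⁻¹ := fun a b hab => by
    by_contra hba
    have := h1.monotone (Nat.le_of_not_lt hba)
    simp only [perm_apply_inv_self] at this
    omega
  ext j
  have h3 := h1.le_apply (x := j)
  have h4 := h2.le_apply (x := w j)
  rw [perm_inv_apply_self] at h4
  exact le_antisymm h4 h3

lemma sum_mul_comp_sTr (a g : ℕ → ℕ) {i N : ℕ} (hN : i + 2 ≤ N) :
    ∑ j ∈ Finset.range N, a j * g (sTr i j) + (a i * g i + a (i + 1) * g (i + 1)) =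
      ∑ j ∈ Finset.range N, a j * g j + (a i * g (i + 1) + a (i + 1) * g i) := by
  induction N, hN using Nat.le_induction with
  | base =>
    rw [Finset.sum_range_succ, Finset.sum_range_succ, Finset.sum_range_succ, Finset.sum_range_succ,
      Finset.sum_congr rfl (g := fun j => a j * g j)]
    · simp only [sTr_apply]
      simp
      ring
    · intro j hj
      rw [Finset.mem_range] at hj
      rw [sTr_apply, if_neg (by omega), if_neg (by omega)]
  | succ N hN ih =>
    rw [Finset.sum_range_succ, Finset.sum_range_succ, sTr_apply i N, if_neg (by omega),
      if_neg (by omega)]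
    omega

/-- Sorting a descent decreases a weighted sum of the values. -/
lemma sum_comp_sTr_lt_of_descent {g : ℕ → ℕ} {i N : ℕ} (hN : i + 2 ≤ N) (h : g (i + 1) < g i) :
    ∑ j ∈ Finset.range N, (N - j) * g (sTr i j) < ∑ j ∈ Finset.range N, (N - j) * g j := by
  have h1 := sum_mul_comp_sTr (fun j => N - j) g hN
  obtain ⟨d, rfl⟩ := Nat.exists_eq_add_of_le hN
  have e1 : i + 2 + d - i = d + 2 := by omega
  have e2 : i + 2 + d - (i + 1) = d + 1 := by omega
  simp only [e1, e2] at h1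
  nlinarith

/-- Creating a descent decreases a weighted sum of the values. -/
lemma sum_comp_sTr_lt_of_ascent {g : ℕ → ℕ} {i N : ℕ} (hN : i + 2 ≤ N) (h : g i < g (i + 1)) :
    ∑ j ∈ Finset.range N, j * g (sTr i j) < ∑ j ∈ Finset.range N, j * g j := by
  have h1 := sum_mul_comp_sTr (fun j => j) g hN
  nlinarith

/-- Induction over `S_n` in left weak order. -/
lemma InSn.left_induction {n : ℕ} {p : Equiv.Perm ℕ → Prop} (one : p 1)
    (step : ∀ i w, i + 1 < n → InSn n w → w⁻¹ i < w⁻¹ (i + 1) → p w → p (sTr i * w))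
    {w : Equiv.Perm ℕ} (hw : InSn n w) : p w := by
  induction hm : ∑ j ∈ Finset.range n, (n - j) * w⁻¹ j using Nat.strong_induction_on
    generalizing w with
  | _ m ih =>
  by_cases h : ∀ i, w⁻¹ i < w⁻¹ (i + 1)
  · rw [inv_eq_one.1 (perm_eq_one_of_forall_lt h)]
    exact one
  push Not at h
  obtain ⟨i, hi⟩ := h
  have hi' := lt_of_le_of_ne hi (perm_apply_ne_succ w⁻¹ i).symm
  have hin := hw.inv.lt_of_descent hi'
  rw [← sTr_mul_cancel i w]
  have hs : InSn n (sTr i * w) := (inSn_sTr hin).mul hw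
  refine step i _ hin hs ?_ (ih _ ?_ hs rfl)
  · simpa only [inv_sTr_mul_apply, sTr_left, sTr_right] using hi'
  · rw [← hm]
    simp only [inv_sTr_mul_apply]
    exact sum_comp_sTr_lt_of_descent hin hi'

end Permutations

/-! ### Divided differences indexed by permutations -/

section DividedDifferencePerm

variable {K : Type*} [Field K]

/-- `IsDD m w T` says that `T` is the composite of divided differences along some reduced word
of length `m` for `w`. -/
inductive IsDD (K : Type*) [Field K] :
    ℕ → Equiv.Perm ℕ → (MvPolynomial ℕ K →ₗ[K] MvPolynomial ℕ K) → Prop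
  | one : IsDD K 0 1 LinearMap.id
  | cons {m w T} (i : ℕ) (h : IsDD K m w T) (hi : w⁻¹ i < w⁻¹ (i + 1)) :
      IsDD K (m + 1) (sTr i * w) (dd i ∘ₗ T)

lemma exists_isDD {w : Equiv.Perm ℕ} (hw : FinPerm w) : ∃ m T, IsDD K m w T := by
  obtain ⟨n, hn⟩ := hw
  refine InSn.left_induction (n := n) (p := fun w => ∃ m T, IsDD K m w T)
    ⟨_, _, IsDD.one⟩ ?_ hn
  rintro i w - - hi ⟨m, T, h⟩
  exact ⟨_, _, h.cons i hi⟩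

lemma IsDD.finPerm {m : ℕ} {w : Equiv.Perm ℕ} {T : MvPolynomial ℕ K →ₗ[K] MvPolynomial ℕ K}
    (h : IsDD K m w T) : FinPerm w := by
  induction h with
  | one => exact finPerm_one
  | cons i _ _ ih => exact (finPerm_sTr i).mul ih

/-- Peeling off a left descent from an element of `S_∞`. -/
lemma IsDD.of_sTr_mul {m i : ℕ} {w : Equiv.Perm ℕ} {T : MvPolynomial ℕ K →ₗ[K] MvPolynomial ℕ K}
    (h : IsDD K m (sTr i * w) T) (hi : w⁻¹ (i + 1) < w⁻¹ i) :
    IsDD K (m + 1) w (dd i ∘ₗ T) := by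
  have := h.cons i (by simpa only [inv_sTr_mul_apply, sTr_left, sTr_right] using hi)
  rwa [sTr_mul_cancel] at this

lemma IsDD.unique {m m' : ℕ} {w : Equiv.Perm ℕ} {T T' : MvPolynomial ℕ K →ₗ[K] MvPolynomial ℕ K}
    (h : IsDD K m w T) (h' : IsDD K m' w T') : m = m' ∧ T = T' := by
  have key : ∀ {i j m1 m2 : ℕ} {w : Equiv.Perm ℕ}
      {T1 T2 : MvPolynomial ℕ K →ₗ[K] MvPolynomial ℕ K}, i ≠ j →
      w⁻¹ (i + 1) < w⁻¹ i → w⁻¹ (j + 1) < w⁻¹ j →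
      IsDD K m1 (sTr i * w) T1 → IsDD K m2 (sTr j * w) T2 →
      (∀ {m' T'}, IsDD K m' (sTr i * w) T' → m1 = m' ∧ T1 = T') →
      (∀ {T'}, IsDD K m1 (sTr j * w) T' → m1 = m2 ∧ T' = T2) →
      m1 = m2 ∧ dd i ∘ₗ T1 = dd j ∘ₗ T2 := by
    intro i j m1 m2 w T1 T2 hij hi hj h1 h2 ih1 ih2
    have hw : FinPerm w := by
      have := (finPerm_sTr i).mul h1.finPerm
      rwa [sTr_mul_cancel] at this
    have hcases : (i + 2 ≤ j ∨ j + 2 ≤ i) ∨ j = i + 1 ∨ i = j + 1 := by omega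
    rcases hcases with hfar | hadj
    · obtain ⟨m3, T3, h3⟩ := exists_isDD (K := K)
        ((finPerm_sTr j).mul ((finPerm_sTr i).mul hw))
      obtain ⟨rfl, rfl⟩ := ih1 (h3.of_sTr_mul (by
        rwa [inv_sTr_mul_apply, inv_sTr_mul_apply, sTr_of_ne, sTr_of_ne] <;> omega))
      rw [sTr_mul_sTr_mul_comm hfar.symm] at h3
      obtain ⟨rfl, rfl⟩ := ih2 (h3.of_sTr_mul (by
        rwa [inv_sTr_mul_apply, inv_sTr_mul_apply, sTr_of_ne, sTr_of_ne] <;> omega))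
      exact ⟨rfl, LinearMap.ext fun f =>
        hfar.elim (fun h => dd_comm h _) (fun h => (dd_comm h _).symm)⟩
    · obtain ⟨m3, T3, h3⟩ := exists_isDD (K := K)
        ((finPerm_sTr i).mul ((finPerm_sTr j).mul ((finPerm_sTr i).mul hw)))
      rcases hadj with rfl | rfl
      · obtain ⟨rfl, rfl⟩ := ih1 ((h3.of_sTr_mul (by
          simpa only [inv_sTr_mul_apply, sTr_left, sTr_right, sTr_apply_add_two,
            sTr_succ_apply] using hj)).of_sTr_mul (by
          simpa only [inv_sTr_mul_apply, sTr_left, sTr_right, sTr_apply_add_two,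
            sTr_succ_apply] using hj.trans hi))
        rw [sTr_mul_braid] at h3
        obtain ⟨rfl, rfl⟩ := ih2 ((h3.of_sTr_mul (by
          simpa only [inv_sTr_mul_apply, sTr_left, sTr_right, sTr_apply_add_two,
            sTr_succ_apply] using hi)).of_sTr_mul (by
          simpa only [inv_sTr_mul_apply, sTr_left, sTr_right, sTr_apply_add_two,
            sTr_succ_apply] using hj.trans hi))
        exact ⟨rfl, LinearMap.ext fun f => dd_braid i _⟩
      · obtain ⟨rfl, rfl⟩ := ih1 ((h3.of_sTr_mul (by
          simpa only [inv_sTr_mul_apply, sTr_left, sTr_right, sTr_apply_add_two,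
            sTr_succ_apply] using hj)).of_sTr_mul (by
          simpa only [inv_sTr_mul_apply, sTr_left, sTr_right, sTr_apply_add_two,
            sTr_succ_apply] using hi.trans hj))
        rw [← sTr_mul_braid] at h3
        obtain ⟨rfl, rfl⟩ := ih2 ((h3.of_sTr_mul (by
          simpa only [inv_sTr_mul_apply, sTr_left, sTr_right, sTr_apply_add_two,
            sTr_succ_apply] using hi)).of_sTr_mul (by
          simpa only [inv_sTr_mul_apply, sTr_left, sTr_right, sTr_apply_add_two,
            sTr_succ_apply] using hi.trans hj))
        exact ⟨rfl, LinearMap.ext fun f => (dd_braid j _).symm⟩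
  induction m using Nat.strong_induction_on generalizing m' w T T' with
  | _ m ih =>
  cases h with
  | one =>
    generalize hx : (1 : Equiv.Perm ℕ) = x at h'
    cases h' with
    | one => exact ⟨rfl, rfl⟩
    | @cons _ w2 _ j h2 hj =>
      exfalso
      have : w2 = sTr j := by rw [← sTr_mul_cancel j w2, ← hx, mul_one]
      rw [this, sTr_inv, sTr_left, sTr_right] at hj
      omega
  | @cons m1 w1 T1 i h1 hi =>
    generalize hx : sTr i * w1 = x at h'
    obtain rfl : w1 = sTr i * x := by rw [← hx, sTr_mul_cancel]
    simp only [inv_sTr_mul_apply, sTr_left, sTr_right] at hi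
    cases h' with
    | one => simp at hi
    | @cons m2 w2 T2 j h2 hj =>
      generalize hy : sTr j * w2 = y at hx hi h1
      obtain rfl : w2 = sTr j * y := by rw [← hy, sTr_mul_cancel]
      simp only [inv_sTr_mul_apply, sTr_left, sTr_right] at hj
      rcases eq_or_ne i j with rfl | hij
      · obtain ⟨rfl, rfl⟩ := ih m1 (Nat.lt_succ_self _) h1 h2
        exact ⟨rfl, rfl⟩
      · have := key hij hi hj h1 h2 (fun h => ih m1 (Nat.lt_succ_self _) h1 h)
          (fun h => ih m1 (Nat.lt_succ_self _) h h2)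
        exact ⟨congrArg (· + 1) this.1, this.2⟩

open Classical in
/-- The divided difference operator `∂_w` (zero by convention unless `w ∈ S_∞`). -/
def ddPerm (w : Equiv.Perm ℕ) : MvPolynomial ℕ K →ₗ[K] MvPolynomial ℕ K :=
  if h : ∃ m T, IsDD K m w T then h.choose_spec.choose else 0

lemma IsDD.ddPerm_eq {m : ℕ} {w : Equiv.Perm ℕ} {T : MvPolynomial ℕ K →ₗ[K] MvPolynomial ℕ K}
    (h : IsDD K m w T) : ddPerm w = T := by
  have hex : ∃ m T, IsDD K m w T := ⟨m, T, h⟩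
  rw [ddPerm, dif_pos hex]
  exact (hex.choose_spec.choose_spec.unique h).2

lemma ddPerm_one : ddPerm (K := K) 1 = LinearMap.id := IsDD.one.ddPerm_eq

lemma ddPerm_sTr_mul {i : ℕ} {w : Equiv.Perm ℕ} (hw : FinPerm w) (hi : w⁻¹ i < w⁻¹ (i + 1))
    (f : MvPolynomial ℕ K) : ddPerm (sTr i * w) f = dd i (ddPerm w f) := by
  obtain ⟨m, T, h⟩ := exists_isDD (K := K) hw
  rw [h.ddPerm_eq, (h.cons i hi).ddPerm_eq, LinearMap.comp_apply]

lemma dd_ddPerm_of_descent {i : ℕ} {w : Equiv.Perm ℕ} (hw : FinPerm w)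
    (hi : w⁻¹ (i + 1) < w⁻¹ i) (f : MvPolynomial ℕ K) : dd i (ddPerm w f) = 0 := by
  rw [← sTr_mul_cancel i w, ddPerm_sTr_mul ((finPerm_sTr i).mul hw), dd_dd]
  simpa only [inv_sTr_mul_apply, sTr_left, sTr_right] using hi

lemma ddPerm_mul_sTr {i : ℕ} {w : Equiv.Perm ℕ} (hw : FinPerm w) (hi : w i < w (i + 1))
    (f : MvPolynomial ℕ K) : ddPerm (w * sTr i) f = ddPerm w (dd i f) := by
  obtain ⟨m, T, h⟩ := exists_isDD (K := K) hw
  clear hw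
  induction h with
  | one =>
    rw [one_mul, ← mul_one (sTr i), ddPerm_sTr_mul finPerm_one (by simp), ddPerm_one]
    rfl
  | @cons m w1 T1 j h1 hj ih =>
    have hw1 := h1.finPerm
    have e1 := perm_inv_apply_self w1 i
    have e2 := perm_inv_apply_self w1 (i + 1)
    have e3 := perm_apply_inv_self w1 j
    have e4 := perm_apply_inv_self w1 (j + 1)
    have hlt : w1 i < w1 (i + 1) := by
      by_contra hcon
      have := perm_apply_ne_succ w1 i
      rw [Equiv.Perm.mul_apply, Equiv.Perm.mul_apply, sTr_apply, sTr_apply] at hi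
      grind
    rw [mul_assoc, ddPerm_sTr_mul (hw1.mul (finPerm_sTr i)), ih hlt, ddPerm_sTr_mul hw1 hj]
    rw [inv_mul_sTr_apply, inv_mul_sTr_apply]
    rw [Equiv.Perm.mul_apply, Equiv.Perm.mul_apply] at hi
    simp only [sTr_apply] at hi ⊢
    grind

lemma ddPerm_eq_zero {i : ℕ} {w : Equiv.Perm ℕ} (hw : FinPerm w) (hi : w (i + 1) < w i)
    {f : MvPolynomial ℕ K} (hf : dd i f = 0) : ddPerm w f = 0 := by
  rw [← mul_sTr_cancel i w, ddPerm_mul_sTr (hw.mul (finPerm_sTr i)), hf, map_zero]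
  rwa [Equiv.Perm.mul_apply, Equiv.Perm.mul_apply, sTr_left, sTr_right]

end DividedDifferencePerm

/-! ### Row partition functions -/

section Rows

variable {A : Type*} [CommRing A]

/-- The weight of a Schubert tile with spectral parameter `x` and north, east and south labels
`N`, `E`, `S`; the west label is then forced to be `N + E - S`. -/
def tile (x : A) (N E S : ℕ) : A :=
  if N = 0 then
    if E = 0 then if S = 0 then x else 0
    else if S = 0 ∨ S = E then 1 else 0
  else if E = 0 then if S = 0 ∨ S = N then 1 else 0
  else if E < N ∧ S = N then 1 else 0

/-- The partition function of the first `j` columns of a single row, with left label `0`, right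
label `a`, top labels `lam` and bottom labels `mu`. -/
def rowZ (τ : ℕ → A) (lam mu : ℕ → ℕ) : ℕ → ℕ → A
  | 0, a => if a = 0 then 1 else 0
  | j + 1, a => tile (τ j) (lam j) a (mu j) * rowZ τ lam mu j (lam j + a - mu j)

lemma rowZ_zero (τ : ℕ → A) (lam mu : ℕ → ℕ) (a : ℕ) :
    rowZ τ lam mu 0 a = if a = 0 then 1 else 0 := rfl

lemma rowZ_succ (τ : ℕ → A) (lam mu : ℕ → ℕ) (j a : ℕ) :
    rowZ τ lam mu (j + 1) a =
      tile (τ j) (lam j) a (mu j) * rowZ τ lam mu j (lam j + a - mu j) := rfl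

lemma rowZ_congr {τ τ' : ℕ → A} {lam lam' mu mu' : ℕ → ℕ} {j : ℕ} (hτ : ∀ c < j, τ c = τ' c)
    (hlam : ∀ c < j, lam c = lam' c) (hmu : ∀ c < j, mu c = mu' c) (a : ℕ) :
    rowZ τ lam mu j a = rowZ τ' lam' mu' j a := by
  induction j generalizing a with
  | zero => rfl
  | succ j ih =>
    rw [rowZ_succ, rowZ_succ, hτ j (by omega), hlam j (by omega), hmu j (by omega),
      ih (fun c hc => hτ c (by omega)) (fun c hc => hlam c (by omega))
        (fun c hc => hmu c (by omega))]

lemma map_tile {B : Type*} [CommRing B] (φ : A →+* B) (x : A) (N E S : ℕ) :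
    φ (tile x N E S) = tile (φ x) N E S := by
  unfold tile
  split_ifs <;> simp

lemma map_rowZ {B : Type*} [CommRing B] (φ : A →+* B) (τ : ℕ → A) (lam mu : ℕ → ℕ) (j a : ℕ) :
    φ (rowZ τ lam mu j a) = rowZ (fun c => φ (τ c)) lam mu j a := by
  induction j generalizing a with
  | zero => simp only [rowZ_zero]; split_ifs <;> simp
  | succ j ih => rw [rowZ_succ, rowZ_succ, map_mul, map_tile, ih]

/-- The north, east, south labels of a tile of nonzero weight. -/
lemma tile_ne_zero {x : A} {N E S : ℕ} (h : tile x N E S ≠ 0) :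
    (N = 0 ∧ E = 0 ∧ S = 0 ∧ N + E - S = 0 ∧ x ≠ 0) ∨
    (N = 0 ∧ 0 < E ∧ S = 0 ∧ N + E - S = E) ∨ (N = 0 ∧ 0 < E ∧ S = E ∧ N + E - S = 0) ∨
    (0 < N ∧ E = 0 ∧ S = 0 ∧ N + E - S = N) ∨ (0 < N ∧ E = 0 ∧ S = N ∧ N + E - S = 0) ∨
    (0 < N ∧ 0 < E ∧ E < N ∧ S = N ∧ N + E - S = E) := by
  unfold tile at h
  split_ifs at h <;> first | exact absurd rfl h | grind

lemma tile_two_columns (x y : A) (N₁ N₂ E S₁ S₂ : ℕ) (hS : S₁ < S₂) (F : ℕ → A) :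
    (x - y) * (tile y N₂ E S₁ * (tile x N₁ (N₂ + E - S₁) S₂ * F (N₁ + (N₂ + E - S₁) - S₂)) -
      if N₂ < N₁ then tile x N₁ E S₂ * (tile y N₂ (N₁ + E - S₂) S₁ * F (N₂ + (N₁ + E - S₂) - S₁))
      else 0) =
    tile y N₂ E S₂ * (tile x N₁ (N₂ + E - S₂) S₁ * F (N₁ + (N₂ + E - S₂) - S₁)) -
      tile x N₂ E S₂ * (tile y N₁ (N₂ + E - S₂) S₁ * F (N₁ + (N₂ + E - S₂) - S₁)) := by
  have hF : ∀ (x y : A) (N₁ N₂ S₁ S₂ : ℕ),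
      tile y N₂ E S₁ * (tile x N₁ (N₂ + E - S₁) S₂ * F (N₁ + (N₂ + E - S₁) - S₂)) =
      tile y N₂ E S₁ * tile x N₁ (N₂ + E - S₁) S₂ * F (N₁ + N₂ + E - (S₁ + S₂)) := by
    intro x y N₁ N₂ S₁ S₂
    by_cases h : tile y N₂ E S₁ = 0
    · simp [h]
    · rw [← mul_assoc]
      congr 2
      have := tile_ne_zero h
      omega
  rw [hF, hF, hF, hF, add_comm N₂ N₁, add_comm S₂ S₁]
  rw [← ite_zero_mul, ← sub_mul, ← sub_mul, ← mul_assoc]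
  congr 1
  unfold tile
  clear hF
  grind (splits := 40)

lemma rowZ_two_columns (τ : ℕ → A) (lam mu : ℕ → ℕ) {i n : ℕ} (hn : i + 2 ≤ n)
    (hmu : mu i < mu (i + 1)) (a : ℕ) :
    (τ i - τ (i + 1)) * (rowZ τ lam (fun c => mu (sTr i c)) n a -
      if lam (i + 1) < lam i then
        rowZ (fun c => τ (sTr i c)) (fun c => lam (sTr i c)) mu n a else 0) =
    rowZ τ lam mu n a - rowZ (fun c => τ (sTr i c)) lam mu n a := by
  induction n, hn using Nat.le_induction generalizing a with
  | base =>
    have h := tile_two_columns (τ i) (τ (i + 1)) (lam i) (lam (i + 1)) a (mu i) (mu (i + 1)) hmu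
      (rowZ τ lam mu i)
    have e : ∀ c < i, sTr i c = c := fun c hc => sTr_of_ne (by omega) (by omega)
    have e1 := rowZ_congr (τ := τ) (lam := lam) (mu := fun c => mu (sTr i c)) (mu' := mu) (j := i)
      (fun _ _ => rfl) (fun _ _ => rfl) (fun c hc => congrArg mu (e c hc))
    have e2 := rowZ_congr (τ := fun c => τ (sTr i c)) (τ' := τ) (lam := fun c => lam (sTr i c))
      (lam' := lam) (mu := mu) (j := i)
      (fun c hc => congrArg τ (e c hc)) (fun c hc => congrArg lam (e c hc)) (fun _ _ => rfl)
    have e3 := rowZ_congr (τ := fun c => τ (sTr i c)) (τ' := τ) (lam := lam) (mu := mu) (j := i)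
      (fun c hc => congrArg τ (e c hc)) (fun _ _ => rfl) (fun _ _ => rfl)
    simp only [rowZ_succ, e1, e2, e3, sTr_left, sTr_right]
    exact h
  | succ n hn ih =>
    have h := ih (lam n + a - mu n)
    simp only [rowZ_succ, sTr_of_ne (show n ≠ i by omega) (show n ≠ i + 1 by omega)]
    rw [← mul_ite_zero, ← mul_sub, ← mul_sub, mul_left_comm, h]

lemma rowZ_eq_zero_of_bottom_zero {τ : ℕ → A} {lam mu : ℕ → ℕ} {j a : ℕ}
    (hmu : ∀ c < j, mu c = 0) (ha : 0 < a) : rowZ τ lam mu j a = 0 := by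
  induction j generalizing a with
  | zero => rw [rowZ_zero, if_neg (by omega)]
  | succ j ih =>
    rw [rowZ_succ]
    by_cases h : tile (τ j) (lam j) a (mu j) = 0
    · rw [h, zero_mul]
    · have h1 := tile_ne_zero h
      have h2 := hmu j (by omega)
      rw [ih (fun c hc => hmu c (by omega)) (by omega), mul_zero]

/-- The row partition function whose bottom labels are `0, …, 0, m + 1, m + 2, …`. -/
lemma rowZ_bottom_one (τ : ℕ → A) (lam : ℕ → ℕ) (m n : ℕ) :
    rowZ τ lam (thetaLab m 1) n 0 =
      if ∀ c < n, lam c = thetaLab m 1 c then ∏ j ∈ Finset.range (min m n), τ j else 0 := by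
  induction n with
  | zero => simp [rowZ_zero]
  | succ n ih =>
    have hsucc : (∀ c < n + 1, lam c = thetaLab m 1 c) ↔
        (∀ c < n, lam c = thetaLab m 1 c) ∧ lam n = thetaLab m 1 n := Nat.forall_lt_succ_right
    rw [rowZ_succ]
    simp only [hsucc]
    rcases Nat.lt_or_ge n m with hnm | hnm
    · have h0 : ∀ c < n + 1, thetaLab m 1 c = 0 := fun c hc => by
        simp only [thetaLab, inv_one, Equiv.Perm.one_apply]
        rw [if_neg (by omega)]
      rw [min_eq_right (by omega : n + 1 ≤ m), Finset.prod_range_succ]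
      rw [min_eq_right hnm.le] at ih
      rcases Nat.eq_zero_or_pos (lam n) with h1 | h1
      · simp only [h0 n (by omega), h1, and_true]
        rw [ih]
        simp only [tile, if_true]
        split_ifs <;> ring
      · rw [h0 n (by omega), if_neg (by omega),
          rowZ_eq_zero_of_bottom_zero (fun c hc => h0 c (by omega)) (by omega), mul_zero]
    · have h0 : thetaLab m 1 n = n + 1 := by
        simp only [thetaLab, inv_one, Equiv.Perm.one_apply]
        rw [if_pos hnm]
      rw [min_eq_left (by omega : m ≤ n + 1)]
      rw [min_eq_left hnm] at ih
      by_cases h1 : lam n = n + 1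
      · simp only [h0, h1, and_true, add_zero, Nat.sub_self]
        rw [ih]
        simp [tile]
      · rw [h0, if_neg (fun h => h1 h.2)]
        have : tile (τ n) (lam n) 0 (n + 1) = 0 := by
          by_contra h
          have := tile_ne_zero h
          omega
        rw [this, zero_mul]

lemma rowZ_eq_zero_of_smaller_top {τ : ℕ → A} {lam mu : ℕ → ℕ} {c q L n : ℕ} (hq : 0 < q)
    (hcn : c < n) (hc : lam c = q) (hlam : ∀ j, c < j → j < n → q < lam j) (hL : q < L) :
    rowZ τ lam mu n L = 0 := by
  induction n, hcn using Nat.le_induction generalizing L with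
  | base =>
    have : tile (τ c) (lam c) L (mu c) = 0 := by
      by_contra h
      have := tile_ne_zero h
      omega
    rw [rowZ_succ, this, zero_mul]
  | succ n hn ih =>
    rw [rowZ_succ]
    by_cases h : tile (τ n) (lam n) L (mu n) = 0
    · rw [h, zero_mul]
    · have h1 := tile_ne_zero h
      have h2 := hlam n (by omega) (by omega)
      rw [ih (fun j h h' => hlam j h (by omega)) (by omega), mul_zero]

/-- A pipe entering from the top to the left of pipes with larger labels may as well enter from
the right. -/
lemma rowZ_top_to_right (τ : ℕ → A) {lam : ℕ → ℕ} (mu : ℕ → ℕ) {c q n : ℕ} (hq : 0 < q)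
    (hcn : c < n) (hc : lam c = q) (hlam : ∀ j, c < j → j < n → q < lam j) :
    rowZ τ lam mu n 0 = rowZ τ (Function.update lam c 0) mu n q := by
  induction n, hcn using Nat.le_induction with
  | base =>
    rw [rowZ_succ, rowZ_succ, Function.update_self, hc, add_zero, zero_add,
      rowZ_congr (fun _ _ => rfl) (lam' := Function.update lam c 0)
        (fun j hj => (Function.update_of_ne (by omega) _ _).symm) (fun _ _ => rfl)]
    simp [tile, hq.ne']
  | succ n hn ih =>
    have h2 := hlam n (by omega) (by omega)
    have h3 := ih (fun j h h' => hlam j h (by omega))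
    rw [rowZ_succ, rowZ_succ, Function.update_of_ne (by omega)]
    by_cases h : mu n = lam n
    · rw [h, add_zero, Nat.sub_self, Nat.add_sub_cancel_left, h3]
      congr 1
      simp [tile, h2, hq.ne', (hq.trans h2).ne']
    · have e1 : tile (τ n) (lam n) q (mu n) = 0 := by
        by_contra h'
        have := tile_ne_zero h'
        omega
      rw [e1, zero_mul]
      by_cases h' : tile (τ n) (lam n) 0 (mu n) = 0
      · rw [h', zero_mul]
      · have := tile_ne_zero h'
        rw [rowZ_eq_zero_of_smaller_top hq hn hc (fun j h h' => hlam j h (by omega)) (by omega),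
          mul_zero]

/-- The pipes of a row leave through the bottom. -/
lemma exists_bottom_iff {τ : ℕ → A} {lam mu : ℕ → ℕ} {j a x : ℕ} (h : rowZ τ lam mu j a ≠ 0)
    (hx : x ≠ 0) : (∃ c < j, mu c = x) ↔ a = x ∨ ∃ c < j, lam c = x := by
  induction j generalizing a with
  | zero =>
    rw [rowZ_zero] at h
    have : a = 0 := by
      by_contra h'
      exact h (if_neg h')
    simp [this, hx.symm]
  | succ j ih =>
    rw [rowZ_succ] at h
    have h1 := tile_ne_zero (left_ne_zero_of_mul h)
    have h2 := ih (right_ne_zero_of_mul h)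
    have e : ∀ f : ℕ → ℕ, (∃ c < j + 1, f c = x) ↔ (∃ c < j, f c = x) ∨ f j = x := fun f => by
      grind
    rw [e, e, h2]
    generalize (∃ c < j, lam c = x) = Q
    grind

/-- The nonzero labels among the first `j` values of `f` are distinct. -/
def DistinctLabels (f : ℕ → ℕ) (j : ℕ) : Prop :=
  ∀ c d, c < j → d < j → f c = f d → f c ≠ 0 → c = d

lemma DistinctLabels.bottom {τ : ℕ → A} {lam mu : ℕ → ℕ} {j a : ℕ}
    (hlam : DistinctLabels lam j) (ha : a ≠ 0 → ∀ c < j, lam c ≠ a)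
    (h : rowZ τ lam mu j a ≠ 0) : DistinctLabels mu j := by
  induction j generalizing a with
  | zero => exact fun c d hc => absurd hc (Nat.not_lt_zero c)
  | succ j ih =>
    rw [rowZ_succ] at h
    have h1 := tile_ne_zero (left_ne_zero_of_mul h)
    have h2 := right_ne_zero_of_mul h
    have h3 : DistinctLabels mu j := by
      refine ih (fun c d hc hd => hlam c d (by omega) (by omega)) ?_ h2
      intro h0 c hc h4
      have := fun h => ha h c (by omega)
      have := hlam c j (by omega) (by omega)
      omega
    have h4 : mu j ≠ 0 → ∀ c < j, mu c ≠ mu j := by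
      intro h0 c hc h5
      rcases (exists_bottom_iff h2 h0).1 ⟨c, hc, h5⟩ with h6 | ⟨d, hd, h6⟩
      · have := fun h => ha h j (by omega)
        omega
      · have := fun h => ha h d (by omega)
        have := hlam d j (by omega) (by omega)
        omega
    intro c d hc hd hcd h0
    rcases Nat.lt_succ_iff_lt_or_eq.1 hc with hc | rfl <;>
      rcases Nat.lt_succ_iff_lt_or_eq.1 hd with hd | rfl
    · exact h3 c d hc hd hcd h0
    · exact absurd hcd (h4 (hcd ▸ h0) c hc)
    · exact absurd hcd.symm (h4 h0 d hd)
    · rfl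

/-- The label `p` occurs to the left of the label `q` among the first `j` values of `f`. -/
def LeftOf (f : ℕ → ℕ) (j p q : ℕ) : Prop := ∃ c d, c < d ∧ d < j ∧ f c = p ∧ f d = q

lemma leftOf_succ {f : ℕ → ℕ} {j p q : ℕ} :
    LeftOf f (j + 1) p q ↔ LeftOf f j p q ∨ ((∃ c < j, f c = p) ∧ f j = q) := by
  constructor
  · rintro ⟨c, d, hcd, hd, hc', hd'⟩
    rcases Nat.lt_succ_iff_lt_or_eq.1 hd with hd | rfl
    · exact Or.inl ⟨c, d, hcd, hd, hc', hd'⟩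
    · exact Or.inr ⟨⟨c, hcd, hc'⟩, hd'⟩
  · rintro (⟨c, d, hcd, hd, hc', hd'⟩ | ⟨⟨c, hc, hc'⟩, hd'⟩)
    · exact ⟨c, d, hcd, by omega, hc', hd'⟩
    · exact ⟨c, j, hc, by omega, hc', hd'⟩

/-- Two pipes that are in order at the top of a row remain in order at its bottom. -/
lemma LeftOf.bottom {τ : ℕ → A} {lam mu : ℕ → ℕ} {j a p q : ℕ} (hp : 0 < p) (hpq : p < q)
    (h : rowZ τ lam mu j a ≠ 0)
    (htop : LeftOf lam j p q ∨ ((∃ c < j, lam c = p) ∧ a = q)) : LeftOf mu j p q := by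
  induction j generalizing a with
  | zero =>
    rcases htop with ⟨c, d, h1, h2, -⟩ | ⟨⟨c, h1, -⟩, -⟩ <;> omega
  | succ j ih =>
    rw [rowZ_succ] at h
    have h1 := tile_ne_zero (left_ne_zero_of_mul h)
    have h2 := right_ne_zero_of_mul h
    have h3 := ih h2
    have h4 := exists_bottom_iff h2 hp.ne'
    have e : (∃ c < j + 1, lam c = p) ↔ (∃ c < j, lam c = p) ∨ lam j = p := by grind
    rw [leftOf_succ, e] at htop
    rw [leftOf_succ, h4]
    generalize (∃ c < j, lam c = p) = Q at *
    generalize LeftOf lam j p q = Q' at *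
    generalize LeftOf mu j p q = Q'' at *
    grind

/-- Exchanging the labels `p` and `p + 1` in a row where they never meet in order. -/
lemma rowZ_exchange {τ : ℕ → A} {lam mu : ℕ → ℕ} {j a p : ℕ} (hp : 0 < p)
    (hlam : ¬ LeftOf lam j p (p + 1)) (ha : ¬ ((∃ c < j, lam c = p) ∧ a = p + 1))
    (hmu : ¬ LeftOf mu j p (p + 1)) :
    rowZ τ lam mu j a =
      rowZ τ (fun c => sTr p (lam c)) (fun c => sTr p (mu c)) j (sTr p a) := by
  induction j generalizing a with
  | zero =>
    have : sTr p a = 0 ↔ a = 0 := by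
      rw [sTr_apply]
      grind
    simp only [rowZ_zero, this]
  | succ j ih =>
    have e : (∃ c < j + 1, lam c = p) ↔ (∃ c < j, lam c = p) ∨ lam j = p := by grind
    rw [leftOf_succ] at hlam hmu
    rw [e] at ha
    rw [rowZ_succ, rowZ_succ]
    by_cases hcross : lam j = p + 1 ∧ a = p
    · have e1 : tile (τ j) (sTr p (lam j)) (sTr p a) (sTr p (mu j)) = 0 := by
        by_contra h
        have := tile_ne_zero h
        rw [hcross.1, hcross.2, sTr_left, sTr_right] at this
        omega
      rw [e1, zero_mul]
      by_contra h
      have h1 := tile_ne_zero (left_ne_zero_of_mul h)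
      have h2 := (exists_bottom_iff (right_ne_zero_of_mul h) hp.ne').2 (Or.inl (by omega))
      exact hmu (Or.inr ⟨h2, by omega⟩)
    have e1 : tile (τ j) (sTr p (lam j)) (sTr p a) (sTr p (mu j)) =
        tile (τ j) (lam j) a (mu j) := by
      unfold tile
      simp only [sTr_apply]
      grind (splits := 30)
    rw [e1]
    by_cases h : tile (τ j) (lam j) a (mu j) = 0
    · rw [h, zero_mul, zero_mul]
    · have h1 := tile_ne_zero h
      have h2 : sTr p (lam j) + sTr p a - sTr p (mu j) = sTr p (lam j + a - mu j) := by
        have e0 : sTr p 0 = 0 := sTr_of_ne (by omega) (by omega)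
        rcases h1 with ⟨h1, h2, h3, h4, -⟩ | ⟨h1, -, h3, h4⟩ | ⟨h1, -, h3, h4⟩ |
          ⟨-, h2, h3, h4⟩ | ⟨-, h2, h3, h4⟩ | ⟨-, -, -, h3, h4⟩ <;> rw [h4] <;> simp [*]
      rw [h2, ih (fun h => hlam (Or.inl h)) _ (fun h => hmu (Or.inl h))]
      generalize (∃ c < j, lam c = p) = Q at *
      grind

lemma rowZ_eq_zero_of_top_pos {τ : ℕ → A} {lam mu : ℕ → ℕ} {j a : ℕ}
    (hlam : ∀ c < j, 0 < lam c) (ha : 0 < a) : rowZ τ lam mu j a = 0 := by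
  induction j generalizing a with
  | zero => rw [rowZ_zero, if_neg (by omega)]
  | succ j ih =>
    rw [rowZ_succ]
    by_cases h : tile (τ j) (lam j) a (mu j) = 0
    · rw [h, zero_mul]
    · have h1 := tile_ne_zero h
      have h2 := hlam j (by omega)
      rw [ih (fun c hc => hlam c (by omega)) (by omega), mul_zero]

lemma bottom_eq_top_of_top_pos {τ : ℕ → A} {lam mu : ℕ → ℕ} {j : ℕ}
    (hlam : ∀ c < j, 0 < lam c) (h : rowZ τ lam mu j 0 ≠ 0) : ∀ c < j, mu c = lam c := by
  induction j with
  | zero => exact fun c hc => absurd hc (Nat.not_lt_zero c)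
  | succ j ih =>
    rw [rowZ_succ] at h
    have h1 := tile_ne_zero (left_ne_zero_of_mul h)
    have h2 := right_ne_zero_of_mul h
    have h0 : ∀ c < j, 0 < lam c := fun c hc => hlam c (by omega)
    have h3 : lam j + 0 - mu j = 0 := by
      by_contra h'
      exact h2 (rowZ_eq_zero_of_top_pos h0 (by omega))
    rw [h3] at h2
    have := hlam j (by omega)
    intro c hc
    rcases Nat.lt_succ_iff_lt_or_eq.1 hc with hc | rfl
    · exact ih h0 h2 c hc
    · omega

lemma rowZ_eq_zero_of_param_zero {τ : ℕ → A} {lam mu : ℕ → ℕ} {r j : ℕ} (hr : r < j)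
    (hτ : τ r = 0) (hlam : ∀ c, r ≤ c → c < j → lam c = 0) : rowZ τ lam mu j 0 = 0 := by
  induction j, hr using Nat.le_induction with
  | base =>
    rw [rowZ_succ, hlam r le_rfl (by omega), hτ]
    simp [tile]
  | succ j hj ih =>
    rw [rowZ_succ]
    by_cases h : tile (τ j) (lam j) 0 (mu j) = 0
    · rw [h, zero_mul]
    · have h1 := tile_ne_zero h
      have h2 := hlam j (by omega) (by omega)
      have h3 : lam j + 0 - mu j = 0 := by omega
      rw [h3, ih (fun c hc hc' => hlam c hc (by omega)), mul_zero]

/-- In a row with a vanishing parameter at the first column without a pipe on top, the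
pipe entering from the right leaves in this column. -/
lemma bottom_eq_of_param_zero {τ : ℕ → A} {lam mu : ℕ → ℕ} {r j a : ℕ} (hr : r < j)
    (hτ : τ r = 0) (hpos : ∀ c < r, 0 < lam c) (hlam : ∀ c, r ≤ c → c < j → lam c = 0)
    (ha : 0 < a) (h : rowZ τ lam mu j a ≠ 0) :
    ∀ c < j, mu c = if c = r then a else lam c := by
  induction j, hr using Nat.le_induction with
  | base =>
    rw [rowZ_succ] at h
    have h1 := tile_ne_zero (left_ne_zero_of_mul h)
    have h2 := right_ne_zero_of_mul h
    have h3 := hlam r le_rfl (by omega)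
    have h4 : lam r + a - mu r = 0 := by
      by_contra h'
      exact h2 (rowZ_eq_zero_of_top_pos hpos (by omega))
    rw [h4] at h2
    intro c hc
    rcases Nat.lt_succ_iff_lt_or_eq.1 hc with hc | rfl
    · rw [if_neg (by omega), bottom_eq_top_of_top_pos hpos h2 c hc]
    · rw [if_pos rfl]
      omega
  | succ j hj ih =>
    rw [rowZ_succ] at h
    have h1 := tile_ne_zero (left_ne_zero_of_mul h)
    have h2 := right_ne_zero_of_mul h
    have h3 := hlam j (by omega) (by omega)
    have h0 : ∀ c, r ≤ c → c < j → lam c = 0 := fun c hc hc' => hlam c hc (by omega)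
    have h4 : lam j + a - mu j ≠ 0 := by
      intro h'
      rw [h'] at h2
      exact h2 (rowZ_eq_zero_of_param_zero hj hτ h0)
    have h5 : lam j + a - mu j = a := by omega
    rw [h5] at h2
    intro c hc
    rcases Nat.lt_succ_iff_lt_or_eq.1 hc with hc | rfl
    · exact ih h0 h2 c hc
    · rw [if_neg (by omega)]
      omega

end Rows

/-! ### The Pieri rule -/

section Pieri

lemma finite_inSn (n : ℕ) : {w : Equiv.Perm ℕ | InSn n w}.Finite := by
  refine Set.Finite.of_injOn (f := fun w (j : Fin n) => w j)
    (t := Set.pi Set.univ fun _ => Set.Iio n) ?_ ?_ (Set.Finite.pi fun _ => Set.finite_Iio n)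
  · exact fun w hw j _ => (InSn.lt_iff hw).2 j.2
  · intro v hv w hw h
    ext j
    by_cases hj : j < n
    · exact congrFun h ⟨j, hj⟩
    · rw [hv j (by omega), hw j (by omega)]

/-- The symmetric group `S_n` as a finite set of permutations of `ℕ`. -/
def permsBelow (n : ℕ) : Finset (Equiv.Perm ℕ) := (finite_inSn n).toFinset

lemma mem_permsBelow {n : ℕ} {w : Equiv.Perm ℕ} : w ∈ permsBelow n ↔ InSn n w :=
  (finite_inSn n).mem_toFinset

/-- The permutation `w` is increasing on the first `m` positions. -/
def IncBelow (m : ℕ) (w : Equiv.Perm ℕ) : Prop := ∀ i, i + 1 < m → w i < w (i + 1)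

lemma IncBelow.lt {m : ℕ} {w : Equiv.Perm ℕ} (h : IncBelow m w) {p q : ℕ} (hpq : p < q)
    (hq : q < m) : w p < w q := by
  induction q, hpq using Nat.le_induction with
  | base => exact h p hq
  | succ q _ ih => exact (ih (by omega)).trans (h q hq)

lemma thetaLab_sTr_mul (m i : ℕ) (w : Equiv.Perm ℕ) :
    thetaLab m (sTr i * w) = fun c => thetaLab m w (sTr i c) := by
  funext c
  rw [thetaLab, thetaLab, inv_sTr_mul_apply]

lemma thetaLab_eq_iff {m n : ℕ} {v w : Equiv.Perm ℕ} (hv : InSn n v) (hw : InSn n w)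
    (hv' : IncBelow m v) (hw' : IncBelow m w) :
    (∀ c < n, thetaLab m v c = thetaLab m w c) ↔ v = w := by
  refine ⟨fun h => ?_, fun h _ _ => by rw [h]⟩
  have hfix : ∀ p, m ≤ p → w⁻¹ (v p) = p := by
    intro p hp
    by_cases hpn : p < n
    · have h1 := h (v p) (hv.lt_iff.2 hpn)
      rw [thetaLab, thetaLab, perm_inv_apply_self, if_pos hp] at h1
      split_ifs at h1
      omega
    · rw [hv p (by omega), hw.inv p (by omega)]
  have hlt : ∀ p, p < m → w⁻¹ (v p) < m := by
    intro p hp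
    by_contra h1
    have h2 := hfix (w⁻¹ (v p)) (by omega)
    have := v.injective (w⁻¹.injective h2)
    omega
  have h1 : w⁻¹ * v = 1 := by
    refine perm_eq_one_of_forall_lt fun i => ?_
    simp only [Equiv.Perm.mul_apply]
    by_cases hi : i + 1 < m
    · by_contra h2
      have h3 := lt_of_le_of_ne (not_lt.1 h2) (perm_apply_ne_succ (w⁻¹ * v) i).symm
      have h4 := hw'.lt h3 (hlt i (by omega))
      rw [perm_apply_inv_self, perm_apply_inv_self] at h4
      exact absurd h4 (hv' i hi).not_gt
    · rw [hfix (i + 1) (by omega)]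
      by_cases hi' : i < m
      · have := hlt i hi'
        omega
      · rw [hfix i (by omega)]
        omega
  rw [inv_mul_eq_one] at h1
  exact h1.symm

variable {K : Type*} [Field K]

lemma ddPerm_eq_zero_of_not_incBelow {m : ℕ} {w : Equiv.Perm ℕ} (hw : FinPerm w)
    (hm : ¬ IncBelow m w) {f : MvPolynomial ℕ K} (hf : ∀ i, i + 1 < m → dd i f = 0) :
    ddPerm w f = 0 := by
  unfold IncBelow at hm
  push Not at hm
  obtain ⟨i, hi, h⟩ := hm
  exact ddPerm_eq_zero hw (lt_of_le_of_ne h (perm_apply_ne_succ w i).symm) (hf i hi)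

/-- The product `(x_1 - y) ⋯ (x_m - y)`. -/
def linProd (m : ℕ) (y : K) : MvPolynomial ℕ K := ∏ i ∈ Finset.range m, (X i - C y)

lemma sAct_rowZ (y : K) (lam mu : ℕ → ℕ) (i n a : ℕ) :
    sAct i (rowZ (fun j => X j - C y : ℕ → MvPolynomial ℕ K) lam mu n a) =
      rowZ (fun j => X (sTr i j) - C y) lam mu n a := by
  have := map_rowZ (sAct i : MvPolynomial ℕ K →ₐ[K] MvPolynomial ℕ K).toRingHom
    (fun j => X j - C y) lam mu n a
  simp only [AlgHom.toRingHom_eq_coe, RingHom.coe_coe, map_sub, rename_X, rename_C] at this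
  exact this

lemma dd_rowZ (y : K) (lam mu : ℕ → ℕ) {i n : ℕ} (hn : i + 2 ≤ n) (hmu : mu i < mu (i + 1))
    (a : ℕ) :
    dd i (rowZ (fun j => X j - C y : ℕ → MvPolynomial ℕ K) lam mu n a) =
      rowZ (fun j => X j - C y) lam (fun c => mu (sTr i c)) n a -
      if lam (i + 1) < lam i then
        sAct i (rowZ (fun j => X j - C y) (fun c => lam (sTr i c)) mu n a) else 0 := by
  refine dd_eq_of_mul_eq ?_
  have := rowZ_two_columns (fun j => X j - C y : ℕ → MvPolynomial ℕ K) lam mu hn hmu a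
  simp only [sAct_rowZ]
  rw [← this]
  ring

lemma ddPerm_linProd_mul {m n : ℕ} (hmn : m ≤ n) (y : K) {f : MvPolynomial ℕ K}
    (hf : ∀ i, i + 1 < m → dd i f = 0) {w : Equiv.Perm ℕ} (hw : InSn n w) (hm : IncBelow m w) :
    ddPerm w (linProd m y * f) = ∑ v ∈ permsBelow n,
      rowZ (fun j => X j - C y) (thetaLab m v) (thetaLab m w) n 0 * ddPerm v f := by
  revert hm
  refine InSn.left_induction (n := n) (p := fun w => IncBelow m w →
    ddPerm w (linProd m y * f) = ∑ v ∈ permsBelow n,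
      rowZ (fun j => X j - C y) (thetaLab m v) (thetaLab m w) n 0 * ddPerm v f) ?_ ?_ hw
  · intro h1
    rw [Finset.sum_eq_single 1]
    · rw [rowZ_bottom_one, if_pos (fun _ _ => rfl), min_eq_left hmn, ddPerm_one]
      rfl
    · intro v hv hv1
      rw [mem_permsBelow] at hv
      by_cases hvm : IncBelow m v
      · rw [rowZ_bottom_one, if_neg, zero_mul]
        rwa [thetaLab_eq_iff hv (inSn_one n) hvm h1]
      · rw [ddPerm_eq_zero_of_not_incBelow hv.finPerm hvm hf, mul_zero]
    · exact fun h => absurd (mem_permsBelow.2 (inSn_one n)) h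
  · intro i w hi hw hwi ih hm
    have hwp := perm_apply_inv_self w i
    have hwq := perm_apply_inv_self w (i + 1)
    have hm' : IncBelow m w := by
      intro a ha
      have h1 := hm a ha
      have := perm_inv_apply_self w a
      have := perm_inv_apply_self w (a + 1)
      rw [Equiv.Perm.mul_apply, Equiv.Perm.mul_apply, sTr_apply, sTr_apply] at h1
      by_contra h2
      have := perm_apply_ne_succ w a
      grind
    have hmu : thetaLab m w i < thetaLab m w (i + 1) := by
      have h1 : m ≤ w⁻¹ (i + 1) := by
        by_contra h2
        have h3 := hm.lt hwi (by omega)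
        rw [Equiv.Perm.mul_apply, Equiv.Perm.mul_apply, hwp, hwq, sTr_left, sTr_right] at h3
        omega
      rw [thetaLab, thetaLab, if_pos h1]
      split_ifs <;> omega
    have hsum : ∑ v ∈ permsBelow n,
        sAct i (rowZ (fun j => X j - C y) (thetaLab m v) (thetaLab m w) n 0) * dd i (ddPerm v f) =
        ∑ v ∈ permsBelow n, (if v⁻¹ (i + 1) < v⁻¹ i then
          sAct i (rowZ (fun j => X j - C y) (fun c => thetaLab m v (sTr i c))
            (thetaLab m w) n 0) else 0) * ddPerm v f := by
      refine Finset.sum_nbij' (fun v => sTr i * v) (fun v => sTr i * v) ?_ ?_ ?_ ?_ ?_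
      · exact fun v hv => mem_permsBelow.2 ((inSn_sTr hi).mul (mem_permsBelow.1 hv))
      · exact fun v hv => mem_permsBelow.2 ((inSn_sTr hi).mul (mem_permsBelow.1 hv))
      · exact fun v _ => sTr_mul_cancel i v
      · exact fun v _ => sTr_mul_cancel i v
      · intro v hv
        have hv' := (mem_permsBelow.1 hv).finPerm
        simp only [thetaLab_sTr_mul, sTr_sTr_apply, inv_sTr_mul_apply, sTr_left, sTr_right]
        by_cases hvi : v⁻¹ i < v⁻¹ (i + 1)
        · rw [if_pos hvi, ddPerm_sTr_mul hv' hvi]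
        · rw [if_neg hvi, zero_mul, dd_ddPerm_of_descent hv'
            (lt_of_le_of_ne (not_lt.1 hvi) (perm_apply_ne_succ v⁻¹ i).symm), mul_zero]
    rw [ddPerm_sTr_mul hw.finPerm hwi, ih hm', map_sum]
    simp only [dd_mul]
    rw [Finset.sum_add_distrib, hsum, ← Finset.sum_add_distrib]
    refine Finset.sum_congr rfl fun v hv => ?_
    rw [mem_permsBelow] at hv
    rw [← add_mul, dd_rowZ y _ _ hi hmu, thetaLab_sTr_mul m i w]
    by_cases hvm : IncBelow m v
    · congr 1
      have hiff : thetaLab m v (i + 1) < thetaLab m v i ↔ v⁻¹ (i + 1) < v⁻¹ i := by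
        have h1 : v⁻¹ (i + 1) < v⁻¹ i → m ≤ v⁻¹ i := by
          intro h2
          by_contra h3
          have h4 := hvm.lt h2 (by omega)
          rw [perm_apply_inv_self, perm_apply_inv_self] at h4
          omega
        have := perm_apply_ne_succ v⁻¹ i
        simp only [thetaLab]
        grind
      simp only [hiff]
      ring
    · rw [ddPerm_eq_zero_of_not_incBelow hv.finPerm hvm hf, mul_zero, mul_zero]

end Pieri

/-! ### Transfer sums -/

section Transfer

variable {A : Type*} [CommRing A]

/-- Extend a row of labels by zero. -/
def extLab {n : ℕ} (lam : Fin n → Fin (n + 1)) (c : ℕ) : ℕ := if h : c < n then lam ⟨c, h⟩ else 0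

lemma extLab_val {n : ℕ} (lam : Fin n → Fin (n + 1)) (j : Fin n) : extLab lam j = lam j := by
  rw [extLab, dif_pos j.2]

/-- The partition function of the first `r` rows, with spectral parameter `τ i j` in row `i` and
column `j`, right labels `κ`, top labels `θ` and bottom labels `mu`. -/
def puzZ (n : ℕ) (τ : ℕ → ℕ → A) (κ θ : ℕ → ℕ) : ℕ → (ℕ → ℕ) → A
  | 0, mu => if ∀ c < n, mu c = θ c then 1 else 0
  | r + 1, mu => ∑ lam : Fin n → Fin (n + 1),
      rowZ (τ r) (extLab lam) mu n (κ r) * puzZ n τ κ θ r (extLab lam)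

lemma puzZ_zero (n : ℕ) (τ : ℕ → ℕ → A) (κ θ mu : ℕ → ℕ) :
    puzZ n τ κ θ 0 mu = if ∀ c < n, mu c = θ c then 1 else 0 := rfl

lemma puzZ_succ (n : ℕ) (τ : ℕ → ℕ → A) (κ θ mu : ℕ → ℕ) (r : ℕ) :
    puzZ n τ κ θ (r + 1) mu = ∑ lam : Fin n → Fin (n + 1),
      rowZ (τ r) (extLab lam) mu n (κ r) * puzZ n τ κ θ r (extLab lam) := rfl

lemma puzZ_congr {n : ℕ} {τ : ℕ → ℕ → A} {κ θ mu mu' : ℕ → ℕ} (h : ∀ c < n, mu c = mu' c)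
    (r : ℕ) : puzZ n τ κ θ r mu = puzZ n τ κ θ r mu' := by
  cases r with
  | zero =>
    rw [puzZ_zero, puzZ_zero]
    congr 1
    exact propext (forall₂_congr fun c hc => by rw [h c hc])
  | succ r =>
    rw [puzZ_succ, puzZ_succ]
    exact Finset.sum_congr rfl fun lam _ => by
      rw [rowZ_congr (fun _ _ => rfl) (fun _ _ => rfl) h]

/-- A nonvanishing partition function has a nonvanishing last row. -/
lemma exists_of_puzZ_succ_ne_zero {n : ℕ} {τ : ℕ → ℕ → A} {κ θ mu : ℕ → ℕ} {r : ℕ}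
    (h : puzZ n τ κ θ (r + 1) mu ≠ 0) : ∃ lam : Fin n → Fin (n + 1),
      rowZ (τ r) (extLab lam) mu n (κ r) ≠ 0 ∧ puzZ n τ κ θ r (extLab lam) ≠ 0 := by
  rw [puzZ_succ] at h
  obtain ⟨lam, -, hlam⟩ := Finset.exists_ne_zero_of_sum_ne_zero h
  exact ⟨lam, left_ne_zero_of_mul hlam, right_ne_zero_of_mul hlam⟩

/-- The pipes entering from the right and from the top have distinct labels. -/
structure DistinctBoundary (n : ℕ) (κ θ : ℕ → ℕ) : Prop where
  top : DistinctLabels θ n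
  right : ∀ r r', κ r = κ r' → κ r ≠ 0 → r = r'
  ne : ∀ r, κ r ≠ 0 → ∀ c < n, θ c ≠ κ r

lemma exists_label_iff {n : ℕ} {τ : ℕ → ℕ → A} {κ θ mu : ℕ → ℕ} {r x : ℕ}
    (h : puzZ n τ κ θ r mu ≠ 0) (hx : x ≠ 0) :
    (∃ c < n, mu c = x) ↔ (∃ c < n, θ c = x) ∨ ∃ r' < r, κ r' = x := by
  induction r generalizing mu with
  | zero =>
    rw [puzZ_zero] at h
    have h1 : ∀ c < n, mu c = θ c := by
      by_contra h'
      exact h (if_neg h')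
    simp only [Nat.not_lt_zero, false_and, exists_false, or_false]
    exact exists_congr fun c => and_congr_right fun hc => by rw [h1 c hc]
  | succ r ih =>
    obtain ⟨lam, h1, h2⟩ := exists_of_puzZ_succ_ne_zero h
    rw [exists_bottom_iff h1 hx, ih h2]
    have : (∃ r' < r + 1, κ r' = x) ↔ (∃ r' < r, κ r' = x) ∨ κ r = x := by grind
    rw [this, or_comm, or_assoc]

lemma DistinctBoundary.distinctLabels {n : ℕ} {τ : ℕ → ℕ → A} {κ θ mu : ℕ → ℕ} {r : ℕ}
    (hκ : DistinctBoundary n κ θ) (h : puzZ n τ κ θ r mu ≠ 0) : DistinctLabels mu n := by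
  induction r generalizing mu with
  | zero =>
    rw [puzZ_zero] at h
    have h1 : ∀ c < n, mu c = θ c := by
      by_contra h'
      exact h (if_neg h')
    intro c d hc hd
    rw [h1 c hc, h1 d hd]
    exact hκ.top c d hc hd
  | succ r ih =>
    obtain ⟨lam, h1, h2⟩ := exists_of_puzZ_succ_ne_zero h
    refine (ih h2).bottom ?_ h1
    intro h0 c hc hcon
    rcases (exists_label_iff h2 h0).1 ⟨c, hc, hcon⟩ with ⟨d, hd, h3⟩ | ⟨r', hr', h3⟩
    · exact hκ.ne r h0 d hd h3
    · have := hκ.right r' r h3 (h3 ▸ h0)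
      omega

lemma exists_perm_of_labels {n M : ℕ} {mu : ℕ → ℕ} (hM : M ≤ n) (hmu : DistinctLabels mu n)
    (hlab : ∀ x, x ≠ 0 → ((∃ c < n, mu c = x) ↔ M < x ∧ x ≤ n)) :
    ∃ v, InSn n v ∧ IncBelow M v ∧ ∀ c < n, thetaLab M v c = mu c := by
  classical
  have hcount : Nat.count (fun c => mu c = 0) n = M := by
    have h1 := Finset.card_filter_add_card_filter_not (s := Finset.range n) (fun c => mu c = 0)
    have h2 : ((Finset.range n).filter fun c => ¬ mu c = 0).image mu = Finset.Ioc M n := by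
      ext x
      simp only [Finset.mem_image, Finset.mem_filter, Finset.mem_range, Finset.mem_Ioc]
      constructor
      · rintro ⟨c, ⟨hc, h0⟩, rfl⟩
        exact (hlab _ h0).1 ⟨c, hc, rfl⟩
      · intro hx
        have h0 : x ≠ 0 := by omega
        obtain ⟨c, hc, rfl⟩ := (hlab x h0).2 hx
        exact ⟨c, ⟨hc, h0⟩, rfl⟩
    have h3 : ((Finset.range n).filter fun c => ¬ mu c = 0).card = n - M := by
      rw [← Nat.card_Ioc, ← h2, Finset.card_image_of_injOn]
      intro c hc d hd hcd
      simp only [Finset.coe_filter, Finset.mem_range, Set.mem_ofPred_eq] at hc hd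
      exact hmu c d hc.1 hd.1 hcd hc.2
    rw [Finset.card_range, h3] at h1
    rw [Nat.count_eq_card_filter_range]
    omega
  set h : ℕ → ℕ := fun c => if n ≤ c then c else
    if mu c = 0 then Nat.count (fun c => mu c = 0) c else mu c - 1 with hdef
  have h_ge : ∀ c, n ≤ c → h c = c := fun c hc => by simp only [hdef, if_pos hc]
  have h_zero : ∀ c, c < n → mu c = 0 → h c = Nat.count (fun c => mu c = 0) c ∧ h c < M :=
    fun c hc h0 => by
      have e : h c = Nat.count (fun c => mu c = 0) c := by
        simp only [hdef, if_neg (Nat.not_le.2 hc), if_pos h0]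
      refine ⟨e, ?_⟩
      rw [e, ← hcount]
      exact Nat.count_strict_mono h0 hc
  have h_pos : ∀ c, c < n → mu c ≠ 0 → h c + 1 = mu c ∧ M ≤ h c ∧ h c < n := fun c hc h0 => by
    have e : h c = mu c - 1 := by
      simp only [hdef, if_neg (Nat.not_le.2 hc), if_neg h0]
    have := (hlab _ h0).1 ⟨c, hc, rfl⟩
    omega
  have h_lt : ∀ c, c < n → h c < n := fun c hc => by
    by_cases h0 : mu c = 0
    · have := (h_zero c hc h0).2
      omega
    · exact (h_pos c hc h0).2.2
  have h_inj : Function.Injective h := by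
    intro c d hcd
    rcases Nat.lt_or_ge c n with hc | hc <;> rcases Nat.lt_or_ge d n with hd | hd
    · by_cases hc0 : mu c = 0 <;> by_cases hd0 : mu d = 0
      · have h1 := h_zero c hc hc0
        have h2 := h_zero d hd hd0
        exact Nat.count_injective hc0 hd0 (by rw [← h1.1, ← h2.1, hcd])
      · have h1 := h_zero c hc hc0
        have h2 := h_pos d hd hd0
        omega
      · have h1 := h_pos c hc hc0
        have h2 := h_zero d hd hd0
        omega
      · have h1 := h_pos c hc hc0
        have h2 := h_pos d hd hd0
        exact hmu c d hc hd (by omega) hc0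
    · have := h_lt c hc
      have := h_ge d hd
      omega
    · have := h_ge c hc
      have := h_lt d hd
      omega
    · rwa [h_ge c hc, h_ge d hd] at hcd
  have h_surj : Function.Surjective h := by
    intro x
    rcases Nat.lt_or_ge x n with hx | hx
    · have := Finset.surjOn_of_injOn_of_card_le (s := Finset.range n) (t := Finset.range n) h
        (fun c hc => by simpa using h_lt c (by simpa using hc)) h_inj.injOn le_rfl
      obtain ⟨c, -, hc⟩ := this (by simpa using hx : x ∈ (Finset.range n : Set ℕ))
      exact ⟨c, hc⟩
    · exact ⟨x, h_ge x hx⟩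
  have hb : Function.Bijective h := ⟨h_inj, h_surj⟩
  set v : Equiv.Perm ℕ := (Equiv.ofBijective h hb)⁻¹ with hv
  have hvinv : ∀ c, v⁻¹ c = h c := fun c => by rw [hv, inv_inv]; rfl
  refine ⟨v, ?_, ?_, ?_⟩
  · rw [← inv_inv v]
    exact InSn.inv fun c hc => by rw [hvinv, h_ge c hc]
  · intro i hi
    have h1 : h (v i) = i := by rw [← hvinv, perm_inv_apply_self]
    have h2 : h (v (i + 1)) = i + 1 := by rw [← hvinv, perm_inv_apply_self]
    have key : ∀ a, h a < M → h a = Nat.count (fun c => mu c = 0) a := fun a ha => by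
      have ha' : a < n := by
        by_contra h3
        have := h_ge a (by omega)
        omega
      by_cases h0 : mu a = 0
      · exact (h_zero a ha' h0).1
      · have := h_pos a ha' h0
        omega
    by_contra h3
    have h4 := Nat.count_monotone (fun c => mu c = 0) (Nat.le_of_not_lt h3)
    rw [← key _ (by omega), ← key _ (by omega)] at h4
    omega
  · intro c hc
    rw [thetaLab, hvinv]
    by_cases h0 : mu c = 0
    · rw [if_neg (by have := (h_zero c hc h0).2; omega), h0]
    · have := h_pos c hc h0
      rw [if_pos this.2.1, this.1]

/-- Sums over rows of labels, rewritten as sums over permutations. -/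
lemma sum_labels_eq_sum_perms {n M : ℕ} (hM : M ≤ n) (F : (ℕ → ℕ) → A)
    (hcongr : ∀ mu mu', (∀ c < n, mu c = mu' c) → F mu = F mu')
    (hF : ∀ mu, F mu ≠ 0 → DistinctLabels mu n ∧
      ∀ x, x ≠ 0 → ((∃ c < n, mu c = x) ↔ M < x ∧ x ≤ n))
    (G : Equiv.Perm ℕ → A) (hG : ∀ v, InSn n v → ¬ IncBelow M v → G v = 0)
    (hFG : ∀ v, InSn n v → IncBelow M v → G v = F (thetaLab M v)) :
    ∑ v ∈ permsBelow n, G v = ∑ lam : Fin n → Fin (n + 1), F (extLab lam) := by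
  classical
  have hlt : ∀ v, InSn n v → ∀ c < n, thetaLab M v c < n + 1 := fun v hv c hc => by
    have := hv.inv.lt_iff.2 hc
    rw [thetaLab]
    split_ifs <;> omega
  rw [← Finset.sum_filter_of_ne (p := IncBelow M)
    (fun v hv h => by_contra fun h' => h (hG v (mem_permsBelow.1 hv) h'))]
  refine Finset.sum_of_injOn
    (fun v j => Fin.ofNat (n + 1) (thetaLab M v j)) ?_ (fun _ _ => Finset.mem_univ _) ?_ ?_
  · intro v hv w hw hvw
    simp only [Finset.coe_filter, mem_permsBelow, Set.mem_ofPred_eq] at hv hw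
    refine (thetaLab_eq_iff hv.1 hw.1 hv.2 hw.2).1 fun c hc => ?_
    have := congrArg Fin.val (congrFun hvw ⟨c, hc⟩)
    simpa [Fin.ofNat, Nat.mod_eq_of_lt (hlt v hv.1 c hc), Nat.mod_eq_of_lt (hlt w hw.1 c hc)]
      using this
  · intro lam _ hlam
    by_contra h0
    obtain ⟨h1, h2⟩ := hF _ h0
    obtain ⟨v, hv, hvM, hvlam⟩ := exists_perm_of_labels hM h1 h2
    refine hlam ⟨v, by simpa [mem_permsBelow] using ⟨hv, hvM⟩, ?_⟩
    funext j
    ext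
    simp [Fin.ofNat, hvlam j j.2, extLab_val, Nat.mod_eq_of_lt (lam j).2]
  · intro v hv
    simp only [Finset.mem_filter, mem_permsBelow] at hv
    rw [hFG v hv.1 hv.2]
    refine hcongr _ _ fun c hc => ?_
    rw [extLab, dif_pos hc]
    simp [Fin.ofNat, Nat.mod_eq_of_lt (hlt v hv.1 c hc)]

end Transfer

section Growth

variable {K : Type*} [Field K]

lemma dd_linProd {m i : ℕ} (hi : i + 1 < m) (y : K) : dd i (linProd m y) = 0 := by
  rw [dd_eq_zero_iff, linProd, map_prod]
  refine Finset.prod_equiv (sTr i) (fun j => ?_) fun j _ => ?_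
  · simp only [Finset.mem_range]
    exact ((inSn_sTr (i := i) (n := m) (by omega)).lt_iff).symm
  · simp only [map_sub, rename_X, rename_C]
    rfl

lemma dd_prod_linProd_mul {M : ℕ → ℕ} {y : ℕ → K} {f : MvPolynomial ℕ K} {i r : ℕ}
    (hM : ∀ j < r, i + 1 < M (j + 1)) (hf : dd i f = 0) :
    dd i ((∏ j ∈ Finset.range r, linProd (M (j + 1)) (y j)) * f) = 0 := by
  rw [dd_eq_zero_iff] at hf ⊢
  rw [map_mul, hf, map_prod]
  congr 1
  exact Finset.prod_congr rfl fun j hj =>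
    dd_eq_zero_iff.1 (dd_linProd (hM j (Finset.mem_range.1 hj)) (y j))

/-- Right boundary labels `κ` that run through `k, k - 1, …, 1` from top to bottom, interspersed
with zeros; `M r` is the number of labels among `1, …, k` not used in the first `r` rows. -/
structure DescendingRight (k : ℕ) (κ M : ℕ → ℕ) : Prop where
  zero : M 0 = k
  step : ∀ r, (κ r = 0 ∧ M (r + 1) = M r) ∨ (κ r = M (r + 1) + 1 ∧ M r = M (r + 1) + 1)

namespace DescendingRight

variable {k : ℕ} {κ M : ℕ → ℕ}

lemma antitone (h : DescendingRight k κ M) : Antitone M :=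
  antitone_nat_of_succ_le fun r => by
    have := h.step r
    omega

lemma le (h : DescendingRight k κ M) (r : ℕ) : M r ≤ k := h.zero ▸ h.antitone (Nat.zero_le r)

lemma exists_iff (h : DescendingRight k κ M) (r : ℕ) {x : ℕ} (hx : x ≠ 0) :
    (∃ r' < r, κ r' = x) ↔ M r < x ∧ x ≤ k := by
  induction r with
  | zero =>
    have := h.zero
    simp only [Nat.not_lt_zero, false_and, exists_false, false_iff]
    omega
  | succ r ih =>
    have h1 : (∃ r' < r + 1, κ r' = x) ↔ (∃ r' < r, κ r' = x) ∨ κ r = x := by grind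
    have h2 := h.step r
    have h3 := h.le r
    rw [h1, ih]
    clear ih h1
    omega

lemma distinctBoundary (h : DescendingRight k κ M) (n : ℕ) (v : Equiv.Perm ℕ) :
    DistinctBoundary n κ (thetaLab k v) where
  top c d _ _ hcd h0 := by
    simp only [thetaLab] at hcd h0
    refine v⁻¹.injective ?_
    split_ifs at hcd h0 <;> omega
  right r r' hr h0 := by
    have h1 := h.step r
    have h2 := h.step r'
    rcases Nat.lt_trichotomy r r' with h3 | h3 | h3
    · have := h.antitone (Nat.succ_le_of_lt h3)
      simp only [Nat.succ_eq_add_one] at this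
      omega
    · exact h3
    · have := h.antitone (Nat.succ_le_of_lt h3)
      simp only [Nat.succ_eq_add_one] at this
      omega
  ne r h0 c _ hc := by
    have h1 := h.step r
    have h2 := h.le r
    rw [thetaLab] at hc
    split_ifs at hc <;> omega

end DescendingRight

lemma exists_thetaLab_iff {n k : ℕ} {v : Equiv.Perm ℕ} (hv : InSn n v) {x : ℕ} (hx : x ≠ 0) :
    (∃ c < n, thetaLab k v c = x) ↔ k < x ∧ x ≤ n := by
  constructor
  · rintro ⟨c, hc, rfl⟩
    have := hv.inv.lt_iff.2 hc
    rw [thetaLab] at hx ⊢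
    split_ifs at hx ⊢ <;> omega
  · intro h
    refine ⟨v (x - 1), hv.lt_iff.2 (by omega), ?_⟩
    rw [thetaLab, perm_inv_apply_self, if_pos (by omega)]
    omega

lemma update_thetaLab (m : ℕ) (v : Equiv.Perm ℕ) :
    Function.update (thetaLab m v) (v m) 0 = thetaLab (m + 1) v := by
  funext c
  by_cases hc : c = v m
  · rw [hc, Function.update_self, thetaLab, perm_inv_apply_self, if_neg (by omega)]
  · rw [Function.update_of_ne hc, thetaLab, thetaLab]
    have : v⁻¹ c ≠ m := fun h => hc (by rw [← h, perm_apply_inv_self])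
    split_ifs <;> omega

/-- The transfer sums compute divided differences of products of the polynomials `linProd`. -/
lemma eval_ddPerm_prod_linProd_mul {n k : ℕ} (hk : k ≤ n) {κ M : ℕ → ℕ}
    (h : DescendingRight k κ M) (t y : ℕ → K) {v : Equiv.Perm ℕ} (hv : InSn n v)
    (hvk : IncBelow k v) {f : MvPolynomial ℕ K} (hf : ∀ i, i + 1 < k → dd i f = 0)
    (hev : eval t (ddPerm v f) = 1) (hev0 : ∀ w, InSn n w → w ≠ v → eval t (ddPerm w f) = 0)
    (r : ℕ) {w : Equiv.Perm ℕ} (hw : InSn n w) (hwM : IncBelow (M r) w) :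
    eval t (ddPerm w ((∏ j ∈ Finset.range r, linProd (M (j + 1)) (y j)) * f)) =
      puzZ n (fun i j => t j - y i) κ (thetaLab k v) r (thetaLab (M r) w) := by
  induction r generalizing w with
  | zero =>
    rw [h.zero] at hwM ⊢
    rw [Finset.prod_range_zero, one_mul, puzZ_zero]
    by_cases hwv : w = v
    · rw [if_pos ((thetaLab_eq_iff hw hv hwM hvk).2 hwv), hwv, hev]
    · rw [if_neg (fun h' => hwv ((thetaLab_eq_iff hw hv hwM hvk).1 h')), hev0 w hw hwv]
  | succ r ih =>
    have hg : ∀ i, i + 1 < M r →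
        dd i ((∏ j ∈ Finset.range r, linProd (M (j + 1)) (y j)) * f) = 0 := fun i hi =>
      dd_prod_linProd_mul (fun j hj => hi.trans_le (h.antitone hj)) (hf i (hi.trans_le (h.le r)))
    have hMle : M (r + 1) ≤ M r := h.antitone (Nat.le_succ r)
    rw [Finset.prod_range_succ, mul_comm (∏ j ∈ Finset.range r, _), mul_assoc,
      ddPerm_linProd_mul ((h.le (r + 1)).trans hk) (y r) (fun i hi => hg i (by omega)) hw hwM,
      map_sum, puzZ_succ]
    refine sum_labels_eq_sum_perms ((h.le r).trans hk) (fun mu => rowZ (fun j => t j - y r) mu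
      (thetaLab (M (r + 1)) w) n (κ r) * puzZ n (fun i j => t j - y i) κ (thetaLab k v) r mu)
      ?_ ?_ _ ?_ ?_
    · intro mu mu' hmu
      rw [rowZ_congr (fun _ _ => rfl) hmu (fun _ _ => rfl), puzZ_congr hmu]
    · intro mu hmu
      have h0 := right_ne_zero_of_mul hmu
      refine ⟨(h.distinctBoundary n v).distinctLabels h0, fun x hx => ?_⟩
      have := h.le r
      rw [exists_label_iff h0 hx, h.exists_iff r hx, exists_thetaLab_iff hv hx]
      omega
    · intro v' hv' hinc
      rw [ddPerm_eq_zero_of_not_incBelow hv'.finPerm hinc hg, mul_zero, map_zero]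
    · intro v' hv' hinc
      rw [map_mul, ih hv' hinc, map_rowZ]
      simp only [map_sub, eval_X, eval_C]
      congr 1
      rcases h.step r with ⟨h1, h2⟩ | ⟨h1, h2⟩
      · rw [h1, h2]
      · have hlt : M (r + 1) < n := by
          have := h.le r
          omega
        rw [rowZ_top_to_right (c := v' (M (r + 1))) (q := M (r + 1) + 1) _ _ (by omega)
          (hv'.lt_iff.2 hlt), update_thetaLab, h1, h2]
        · rw [thetaLab, perm_inv_apply_self, if_pos le_rfl]
        · intro j hj _
          have hne : v'⁻¹ j ≠ M (r + 1) := fun e => by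
            rw [← e, perm_apply_inv_self] at hj
            omega
          have hge : ¬ v'⁻¹ j < M (r + 1) := fun e => by
            have := hinc.lt e (by omega)
            rw [perm_apply_inv_self] at this
            omega
          rw [thetaLab, if_pos (by omega)]
          omega

end Growth

/-! ### Double Schubert polynomials -/

section Schubert

variable {K : Type*} [Field K]

/-- The defining properties of the double Schubert polynomials with second set of variables
evaluated at `t`. -/
structure IsSchubert (t : ℕ → K) (S : Equiv.Perm ℕ → MvPolynomial ℕ K) : Prop where
  top : ∀ n, S (revPerm n) =
    ∏ i ∈ Finset.range n, ∏ j ∈ Finset.range (n - 1 - i), (X i - C (t j))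
  step : ∀ (w : Equiv.Perm ℕ) (i : ℕ), w (i + 1) < w i → S (w * sTr i) = dd i (S w)

lemma GrothFamily.isSchubert {S : (ℕ → K) → Equiv.Perm ℕ → MvPolynomial ℕ K}
    (hS : GrothFamily (0 : K) S) (t : ℕ → K) : IsSchubert t (S t) where
  top n := by
    rw [(hS t (by simp)).1 n]
    simp
  step w i hwi := by
    have := (hS t (by simp)).2 w i hwi
    refine (dd_eq_of_mul_eq ?_).symm
    simpa using this

lemma revPerm_mul_self (n : ℕ) : revPerm n * revPerm n = 1 :=
  Equiv.ext fun j => (revPerm n).left_inv j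

lemma revPerm_apply {n j : ℕ} (hj : j < n) : revPerm n j = n - 1 - j := if_pos hj

lemma eq_one_of_incBelow {n : ℕ} {w : Equiv.Perm ℕ} (hw : InSn n w) (h : IncBelow n w) :
    w = 1 := by
  refine (thetaLab_eq_iff hw (inSn_one n) h fun i _ => ?_).1 fun c hc => ?_
  · exact Nat.lt_succ_self i
  · rw [thetaLab, thetaLab, if_neg (Nat.not_le.2 (hw.inv.lt_iff.2 hc)),
      if_neg (Nat.not_le.2 ((inSn_one n).inv.lt_iff.2 hc))]

lemma ddPerm_one_poly {n : ℕ} {w : Equiv.Perm ℕ} (hw : InSn n w) (h : w ≠ 1) :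
    ddPerm w (1 : MvPolynomial ℕ K) = 0 :=
  ddPerm_eq_zero_of_not_incBelow hw.finPerm (fun h' => h (eq_one_of_incBelow hw h'))
    fun _ _ => dd_eq_zero_iff.2 (map_one _)

/-- On the diagonal specialization only one bottom row has a nonzero transfer sum. -/
lemma bottom_eq_of_puzZ_diag_ne_zero {N : ℕ} {t : ℕ → K} {r : ℕ} (hr : r ≤ N) {mu : ℕ → ℕ}
    (h : puzZ N (fun i j => t j - t i) (fun r => N - r) (thetaLab N 1) r mu ≠ 0) :
    ∀ c < N, mu c = if c < r then N - c else 0 := by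
  induction r generalizing mu with
  | zero =>
    rw [puzZ_zero] at h
    intro c hc
    have h1 : ∀ c < N, mu c = thetaLab N 1 c := by
      by_contra h'
      exact h (if_neg h')
    rw [h1 c hc, thetaLab, if_neg (Nat.not_le.2 ((inSn_one N).inv.lt_iff.2 hc)),
      if_neg (Nat.not_lt_zero c)]
  | succ r ih =>
    obtain ⟨lam, h1, h2⟩ := exists_of_puzZ_succ_ne_zero h
    have h3 := ih (by omega) h2
    intro c hc
    rw [bottom_eq_of_param_zero (r := r) (by omega) (sub_self (t r))
      (fun c hc => by rw [h3 c (by omega), if_pos hc]; omega)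
      (fun c hc hcN => by rw [h3 c hcN, if_neg (by omega)]) (by omega) h1 c hc, h3 c hc]
    split_ifs <;> omega

lemma descendingRight_sub (N : ℕ) : DescendingRight N (fun r => N - r) (fun r => N - r) where
  zero := rfl
  step r := by omega

namespace IsSchubert

variable {t : ℕ → K} {S : Equiv.Perm ℕ → MvPolynomial ℕ K}

lemma one (hS : IsSchubert t S) : S 1 = 1 := by
  have h : revPerm 0 = 1 := Equiv.ext fun j => inSn_revPerm 0 j (Nat.zero_le j)
  rw [← h, hS.top 0, Finset.prod_range_zero]

lemma dd_eq_zero (hS : IsSchubert t S) {w : Equiv.Perm ℕ} {i : ℕ} (h : w i < w (i + 1)) :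
    dd i (S w) = 0 := by
  have := hS.step (w * sTr i) i (by
    rw [Equiv.Perm.mul_apply, Equiv.Perm.mul_apply, sTr_right, sTr_left]
    exact h)
  rw [mul_sTr_cancel] at this
  rw [this, dd_dd]

lemma top_eq_prod_linProd (hS : IsSchubert t S) (N : ℕ) :
    S (revPerm N) = ∏ j ∈ Finset.range N, linProd (N - (j + 1)) (t j) := by
  rw [hS.top N]
  refine Finset.prod_comm' fun i j => ?_
  simp only [Finset.mem_range]
  omega

lemma ddPerm_top (hS : IsSchubert t S) {N : ℕ} {g : Equiv.Perm ℕ} (hg : InSn N g) :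
    ddPerm g (S (revPerm N)) = S (revPerm N * g⁻¹) := by
  refine InSn.left_induction (n := N)
    (p := fun g => ddPerm g (S (revPerm N)) = S (revPerm N * g⁻¹)) ?_ ?_ hg
  · rw [ddPerm_one, inv_one, mul_one]
    rfl
  · intro i g hi hg hgi ih
    rw [ddPerm_sTr_mul hg.finPerm hgi, ih, mul_inv_rev, sTr_inv, ← mul_assoc]
    refine (hS.step _ i ?_).symm
    have h1 := hg.inv.lt_iff.2 hi
    rw [Equiv.Perm.mul_apply, Equiv.Perm.mul_apply, revPerm_apply h1, revPerm_apply (by omega)]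
    omega

lemma eval_eq_zero (hS : IsSchubert t S) {w : Equiv.Perm ℕ} (hw : FinPerm w) (h1 : w ≠ 1) :
    eval t (S w) = 0 := by
  obtain ⟨N, hN⟩ := hw
  have hw : InSn N w := hN
  set g := w⁻¹ * revPerm N with hg
  have hgN : InSn N g := hw.inv.mul (inSn_revPerm N)
  have hwg : w = revPerm N * g⁻¹ := by rw [hg, mul_inv_rev, inv_inv, mul_inv_cancel_left]
  rw [hwg, ← hS.ddPerm_top hgN, hS.top_eq_prod_linProd, ← mul_one (∏ j ∈ Finset.range N, _),
    eval_ddPerm_prod_linProd_mul (M := fun r => N - r) le_rfl (descendingRight_sub N) t t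
      (inSn_one N) (fun i _ => Nat.lt_succ_self i) (fun i _ => dd_eq_zero_iff.2 (map_one _))
      (by rw [ddPerm_one]; exact map_one _)
      (fun w hw hw1 => by rw [ddPerm_one_poly hw hw1, map_zero]) N hgN
      (fun i hi => by omega)]
  by_contra h
  have h2 := bottom_eq_of_puzZ_diag_ne_zero le_rfl h
  refine h1 ?_
  have h3 : g⁻¹ = revPerm N := by
    refine Equiv.ext fun c => ?_
    by_cases hc : c < N
    · have := h2 c hc
      rw [if_pos hc, thetaLab, if_pos (by omega)] at this
      rw [revPerm_apply hc]
      omega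
    · rw [hgN.inv c (by omega), inSn_revPerm N c (by omega)]
  rw [hwg, h3, revPerm_mul_self]

/-- Divided differences followed by evaluation at `x = t` are dual to Schubert polynomials. -/
lemma eval_ddPerm (hS : IsSchubert t S) {w : Equiv.Perm ℕ} (hw : FinPerm w)
    {w' : Equiv.Perm ℕ} (hw' : FinPerm w') :
    (w = w' → eval t (ddPerm w (S w')) = 1) ∧ (w ≠ w' → eval t (ddPerm w (S w')) = 0) := by
  obtain ⟨N, hN⟩ := hw
  have hw : InSn N w := hN
  rw [← inv_inv w]
  refine InSn.left_induction (n := N) (p := fun w => ∀ w', FinPerm w' →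
    (w⁻¹ = w' → eval t (ddPerm w⁻¹ (S w')) = 1) ∧
      (w⁻¹ ≠ w' → eval t (ddPerm w⁻¹ (S w')) = 0)) ?_ ?_ hw.inv w' hw'
  · intro w' hw'
    rw [inv_one, ddPerm_one, LinearMap.id_apply]
    refine ⟨fun h => ?_, fun h => hS.eval_eq_zero hw' h.symm⟩
    rw [← h, hS.one, map_one]
  · intro i g hi hg hgi ih w' hw'
    rw [mul_inv_rev, sTr_inv, ddPerm_mul_sTr hg.inv.finPerm hgi]
    rcases lt_or_gt_of_ne (perm_apply_ne_succ w' i) with h | h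
    · rw [hS.dd_eq_zero h]
      refine ⟨fun h' => ?_, fun _ => by rw [map_zero, map_zero]⟩
      rw [← h', Equiv.Perm.mul_apply, Equiv.Perm.mul_apply, sTr_right, sTr_left] at h
      omega
    · rw [← hS.step w' i h]
      have := ih (w' * sTr i) (hw'.mul (finPerm_sTr i))
      refine ⟨fun h' => this.1 ?_, fun h' => this.2 fun h'' => h' ?_⟩
      · rw [← h', mul_sTr_cancel]
      · rw [h'', mul_sTr_cancel]

end IsSchubert

lemma StructConsts.eq_eval_ddPerm {S : (ℕ → K) → Equiv.Perm ℕ → MvPolynomial ℕ K}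
    {c : (ℕ → K) → (ℕ → K) → Equiv.Perm ℕ → Equiv.Perm ℕ → Equiv.Perm ℕ → K}
    (hS : GrothFamily (0 : K) S) (hc : StructConsts (0 : K) S c) (t y : ℕ → K)
    {u v w : Equiv.Perm ℕ} (hu : FinPerm u) (hv : FinPerm v) (hw : FinPerm w) :
    c t y u v w = eval t (ddPerm w (S y u * S t v)) := by
  classical
  obtain ⟨hfin, hzero, hsum⟩ := hc t y (by simp) (by simp) u v hu hv
  rw [hsum, finsum_eq_sum_of_support_subset (s := insert w hfin.toFinset) _ ?_, map_sum, map_sum,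
    Finset.sum_eq_single w]
  · rw [← smul_eq_C_mul, map_smul, smul_eval, ((hS.isSchubert t).eval_ddPerm hw hw).1 rfl, mul_one]
  · intro w' _ hne
    rw [← smul_eq_C_mul, map_smul, smul_eval]
    by_cases hw' : FinPerm w'
    · rw [((hS.isSchubert t).eval_ddPerm hw hw').2 hne.symm, mul_zero]
    · rw [hzero w' hw', zero_mul]
  · exact fun h => absurd (Finset.mem_insert_self _ _) h
  · intro w' hw'
    rw [Finset.coe_insert, Set.Finite.coe_toFinset]
    refine Or.inr fun h0 => hw' ?_
    simp only [h0, map_zero, zero_mul]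

end Schubert

/-! ### Dominant permutations -/

section Dominant

variable {K : Type*} [Field K]

/-- The Lehmer code of a permutation of `{0, …, N - 1}`. -/
def lehmer (N : ℕ) (w : Equiv.Perm ℕ) (p : ℕ) : ℕ :=
  ((Finset.range N).filter fun q => p < q ∧ w q < w p).card

lemma lehmer_mul_sTr_left {N r : ℕ} {w : Equiv.Perm ℕ} (hr : r + 1 < N)
    (h : w r < w (r + 1)) : lehmer N (w * sTr r) r = lehmer N w (r + 1) + 1 := by
  have : ((Finset.range N).filter fun q => r < q ∧ (w * sTr r) q < (w * sTr r) r) =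
      insert (r + 1) ((Finset.range N).filter fun q => r + 1 < q ∧ w q < w (r + 1)) := by
    ext q
    simp only [Finset.mem_insert, Finset.mem_filter, Finset.mem_range, Equiv.Perm.mul_apply,
      sTr_left]
    rcases lt_trichotomy q (r + 1) with hq | rfl | hq
    · omega
    · rw [sTr_right]
      omega
    · rw [sTr_of_ne (by omega) (by omega)]
      omega
  rw [lehmer, this, Finset.card_insert_of_notMem (by simp), lehmer]

lemma lehmer_mul_sTr_right {N r : ℕ} {w : Equiv.Perm ℕ} (h : w r < w (r + 1)) :
    lehmer N (w * sTr r) (r + 1) = lehmer N w r := by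
  rw [lehmer, lehmer]
  congr 1
  ext q
  simp only [Finset.mem_filter, Finset.mem_range, Equiv.Perm.mul_apply, sTr_right]
  rcases lt_trichotomy q (r + 1) with hq | rfl | hq
  · omega
  · omega
  · rw [sTr_of_ne (by omega) (by omega)]
    omega

lemma lehmer_mul_sTr_of_ne {N r p : ℕ} {w : Equiv.Perm ℕ} (hr : r + 1 < N) (h1 : p ≠ r)
    (h2 : p ≠ r + 1) : lehmer N (w * sTr r) p = lehmer N w p := by
  rw [lehmer, lehmer]
  refine Finset.card_equiv (sTr r) fun q => ?_
  have hq := (inSn_sTr (i := r) (n := N) hr).lt_iff (j := q)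
  simp only [Finset.mem_filter, Finset.mem_range, Equiv.Perm.mul_apply, sTr_of_ne h1 h2, hq]
  have : p < sTr r q ↔ p < q := by
    rw [sTr_apply]
    split_ifs <;> omega
  rw [this]

lemma lehmer_lt_of_descent {N r : ℕ} {w : Equiv.Perm ℕ} (hr : r + 1 < N)
    (h : w (r + 1) < w r) : lehmer N w (r + 1) < lehmer N w r := by
  refine Finset.card_lt_card (Finset.ssubset_iff_of_subset ?_ |>.2 ⟨r + 1, ?_, ?_⟩)
  · intro q hq
    simp only [Finset.mem_filter, Finset.mem_range] at hq ⊢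
    omega
  · simpa using ⟨hr, h⟩
  · simp

lemma lehmer_le_of_ascent {N r : ℕ} {w : Equiv.Perm ℕ} (h : w r < w (r + 1)) :
    lehmer N w r ≤ lehmer N w (r + 1) := by
  refine Finset.card_le_card fun q hq => ?_
  simp only [Finset.mem_filter, Finset.mem_range] at hq ⊢
  have : q ≠ r + 1 := fun e => by
    rw [e] at hq
    omega
  omega

lemma lehmer_revPerm {N p : ℕ} (hp : p < N) : lehmer N (revPerm N) p = N - 1 - p := by
  have : ((Finset.range N).filter fun q => p < q ∧ revPerm N q < revPerm N p) =
      Finset.Ioo p N := by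
    ext q
    simp only [Finset.mem_filter, Finset.mem_range, Finset.mem_Ioo]
    constructor
    · omega
    · intro hq
      rw [revPerm_apply hp, revPerm_apply hq.2]
      omega
  rw [lehmer, this, Nat.card_Ioo]
  omega

/-- The product of the linear forms `X p - y j` over the cells `(p, j)` of a diagram with row
lengths `c`. -/
def diagramProd (N : ℕ) (c : ℕ → ℕ) (y : ℕ → K) : MvPolynomial ℕ K :=
  ∏ p ∈ Finset.range N, ∏ j ∈ Finset.range (c p), (X p - C (y j))

lemma dd_diagramProd {N r : ℕ} (hr : r + 1 < N) {c : ℕ → ℕ} (hc : c r = c (r + 1)) (y : ℕ → K) :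
    dd r (diagramProd N c y) = 0 := by
  rw [dd_eq_zero_iff, diagramProd, map_prod]
  refine Finset.prod_equiv (sTr r) (fun j => ?_) fun p _ => ?_
  · simp only [Finset.mem_range]
    exact ((inSn_sTr (i := r) (n := N) (by omega)).lt_iff).symm
  · have : c (sTr r p) = c p := by
      rw [sTr_apply]
      split_ifs with h1 h2
      · rw [h1, hc]
      · rw [h2, hc]
      · rfl
    rw [this, map_prod]
    refine Finset.prod_congr rfl fun j _ => ?_
    simp only [map_sub, rename_X, rename_C]
    rfl

lemma diagramProd_add_box {N r : ℕ} (hr : r < N) {c c' : ℕ → ℕ} (h1 : c' r = c r + 1)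
    (h2 : ∀ p, p ≠ r → c' p = c p) (y : ℕ → K) :
    diagramProd N c' y = diagramProd N c y * (X r - C (y (c r))) := by
  rw [diagramProd, diagramProd, ← Finset.mul_prod_erase _ _ (Finset.mem_range.2 hr),
    ← Finset.mul_prod_erase _ _ (Finset.mem_range.2 hr), h1, Finset.prod_range_succ]
  have : ∏ p ∈ (Finset.range N).erase r, ∏ j ∈ Finset.range (c' p), (X p - C (y j)) =
      ∏ p ∈ (Finset.range N).erase r, ∏ j ∈ Finset.range (c p), (X p - C (y j)) :=
    Finset.prod_congr rfl fun p hp => by rw [h2 p (Finset.ne_of_mem_erase hp)]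
  rw [this]
  ring

lemma eq_revPerm_of_decreasing {N : ℕ} {w : Equiv.Perm ℕ} (hw : InSn N w)
    (h : ∀ i, i + 1 < N → w (i + 1) < w i) : w = revPerm N := by
  have h1 : revPerm N * w = 1 := by
    refine eq_one_of_incBelow ((inSn_revPerm N).mul hw) fun i hi => ?_
    have h2 := h i hi
    have h3 := hw.lt_iff.2 (show i < N by omega)
    rw [Equiv.Perm.mul_apply, Equiv.Perm.mul_apply, revPerm_apply h3, revPerm_apply (by omega)]
    omega
  calc w = revPerm N * revPerm N * w := by rw [revPerm_mul_self, one_mul]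
    _ = revPerm N := by rw [mul_assoc, h1, mul_one]

/-- Double Schubert polynomials of dominant permutations are products of linear forms. -/
lemma IsSchubert.dominant {y : ℕ → K} {S : Equiv.Perm ℕ → MvPolynomial ℕ K}
    (hS : IsSchubert y S) {N : ℕ} {w : Equiv.Perm ℕ} (hw : InSn N w)
    (hdom : ∀ p, lehmer N w (p + 1) ≤ lehmer N w p) :
    S w = diagramProd N (lehmer N w) y := by
  induction hm : ∑ j ∈ Finset.range N, j * w j using Nat.strong_induction_on generalizing w with
  | _ m ih =>
    by_cases hdec : ∀ i, i + 1 < N → w (i + 1) < w i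
    · rw [eq_revPerm_of_decreasing hw hdec, hS.top, diagramProd]
      exact Finset.prod_congr rfl fun p hp => by rw [lehmer_revPerm (Finset.mem_range.1 hp)]
    · push Not at hdec
      classical
      set r := Nat.find hdec with hr
      obtain ⟨hrN, hasc'⟩ := Nat.find_spec hdec
      rw [← hr] at hrN hasc'
      have hasc : w r < w (r + 1) := lt_of_le_of_ne hasc' (perm_apply_ne_succ w r)
      have hmin : ∀ i < r, w (i + 1) < w i := fun i hi => by
        have := Nat.find_min hdec hi
        push Not at this
        exact this (by omega)
      have hceq : lehmer N w r = lehmer N w (r + 1) :=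
        le_antisymm (lehmer_le_of_ascent hasc) (hdom r)
      have hc1 : lehmer N (w * sTr r) r = lehmer N w r + 1 := by
        rw [lehmer_mul_sTr_left hrN hasc, hceq]
      have hc2 : ∀ p, p ≠ r → lehmer N (w * sTr r) p = lehmer N w p := fun p hp => by
        by_cases hp' : p = r + 1
        · rw [hp', lehmer_mul_sTr_right hasc, hceq]
        · exact lehmer_mul_sTr_of_ne hrN hp hp'
      have hS' : S (w * sTr r) = diagramProd N (lehmer N (w * sTr r)) y := by
        refine ih _ ?_ (hw.mul (inSn_sTr hrN)) (fun p => ?_) rfl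
        · rw [← hm]
          exact sum_comp_sTr_lt_of_ascent hrN hasc
        · by_cases hp : p = r
          · rw [hp, hc1, hc2 (r + 1) (by omega)]
            have := hdom r
            omega
          · rw [hc2 p hp]
            by_cases hp' : p + 1 = r
            · rw [hp', hc1, ← hp']
              exact lehmer_lt_of_descent (by omega) (hmin p (by omega))
            · rw [hc2 _ hp']
              exact hdom p
      have hdes : (w * sTr r) (r + 1) < (w * sTr r) r := by
        rwa [Equiv.Perm.mul_apply, Equiv.Perm.mul_apply, sTr_right, sTr_left]
      have := hS.step _ r hdes
      rw [mul_sTr_cancel] at this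
      rw [this, hS', diagramProd_add_box (by omega) hc1 hc2,
        dd_mul_of_dd_left_eq_zero _ (dd_diagramProd hrN hceq y), dd_X_sub_C, mul_one]

end Dominant

section Decreasing

variable {K : Type*} [Field K]

/-- The permutation `u` is decreasing on the first `k` positions and increasing afterwards. -/
structure DecInc (k : ℕ) (u : Equiv.Perm ℕ) : Prop where
  dec : ∀ i, i + 1 < k → u (i + 1) < u i
  inc : ∀ i, k ≤ i → u i < u (i + 1)

namespace DecInc

variable {k : ℕ} {u : Equiv.Perm ℕ}

lemma lt_of_lt (h : DecInc k u) {p q : ℕ} (hpq : p < q) (hq : q < k) : u q < u p := by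
  induction q, hpq using Nat.le_induction with
  | base => exact h.dec p hq
  | succ q _ ih => exact (h.dec q hq).trans (ih (by omega))

lemma lt_of_le (h : DecInc k u) {p q : ℕ} (hp : k ≤ p) (hpq : p < q) : u p < u q := by
  induction q, hpq using Nat.le_induction with
  | base => exact h.inc p hp
  | succ q hq ih => exact ih.trans (h.inc q (by omega))

lemma lehmer_of_lt (h : DecInc k u) {n : ℕ} (hu : InSn n u) (hk : k ≤ n) {p : ℕ} (hp : p < k) :
    lehmer n u p = u p := by
  rw [← Finset.card_range (u p), lehmer]
  refine Finset.card_equiv u fun q => ?_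
  simp only [Finset.mem_filter, Finset.mem_range]
  refine ⟨fun hq => hq.2.2, fun hq => ⟨?_, ?_, hq⟩⟩
  · have := hu.lt_iff (j := p)
    refine hu.lt_iff.1 ?_
    omega
  · by_contra h'
    rcases Nat.lt_or_eq_of_le (Nat.le_of_not_lt h') with h1 | h1
    · have := h.lt_of_lt h1 hp
      omega
    · rw [h1] at hq
      omega

lemma lehmer_of_ge (h : DecInc k u) (n : ℕ) {p : ℕ} (hp : k ≤ p) : lehmer n u p = 0 := by
  rw [lehmer, Finset.card_eq_zero, Finset.filter_eq_empty_iff]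
  rintro q - ⟨hq, h'⟩
  have := h.lt_of_le hp hq
  omega

/-- The number of positions below `k` where `u` takes a value at least `r`. -/
def height (k : ℕ) (u : Equiv.Perm ℕ) (r : ℕ) : ℕ :=
  Nat.find (p := fun p => ¬ (p < k ∧ r ≤ u p)) ⟨k, fun h => Nat.lt_irrefl k h.1⟩

lemma lt_height_iff (h : DecInc k u) {r p : ℕ} : p < height k u r ↔ p < k ∧ r ≤ u p := by
  constructor
  · intro hp
    exact not_not.1 (Nat.find_min _ hp)
  · intro hp
    by_contra hlt
    have hspec := Nat.find_spec (p := fun p => ¬ (p < k ∧ r ≤ u p))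
      ⟨k, fun h => Nat.lt_irrefl k h.1⟩
    change ¬ (height k u r < k ∧ r ≤ u (height k u r)) at hspec
    rcases Nat.lt_or_eq_of_le (Nat.le_of_not_lt hlt) with h1 | h1
    · have := h.lt_of_lt h1 hp.1
      omega
    · rw [h1] at hspec
      exact hspec hp

lemma descendingRight (h : DecInc k u) : DescendingRight k (kappaLab k u) (height k u) where
  zero := by
    refine eq_of_forall_lt_iff fun p => ?_
    rw [h.lt_height_iff]
    exact and_iff_left (Nat.zero_le _)
  step r := by
    by_cases hr : u⁻¹ r < k
    · right
      have hval := perm_apply_inv_self u r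
      have h1 : height k u r = u⁻¹ r + 1 := by
        refine eq_of_forall_lt_iff fun p => ?_
        rw [h.lt_height_iff]
        rcases lt_trichotomy p (u⁻¹ r) with hp | hp | hp
        · have := h.lt_of_lt hp hr
          omega
        · rw [hp]
          omega
        · constructor
          · intro hp'
            have := h.lt_of_lt hp hp'.1
            omega
          · omega
      have h2 : height k u (r + 1) = u⁻¹ r := by
        refine eq_of_forall_lt_iff fun p => ?_
        rw [h.lt_height_iff]
        rcases lt_trichotomy p (u⁻¹ r) with hp | hp | hp
        · have := h.lt_of_lt hp hr
          omega
        · rw [hp]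
          omega
        · constructor
          · intro hp'
            have := h.lt_of_lt hp hp'.1
            omega
          · omega
      rw [kappaLab, if_pos hr, h1, h2]
      exact ⟨rfl, rfl⟩
    · left
      refine ⟨if_neg hr, eq_of_forall_lt_iff fun p => ?_⟩
      rw [h.lt_height_iff, h.lt_height_iff]
      have : p < k → u p ≠ r := fun hp e => hr (by rwa [← e, perm_inv_apply_self])
      constructor
      · omega
      · intro hp
        have := this hp.1
        omega

lemma schubert_eq (h : DecInc k u) {y : ℕ → K} {S : Equiv.Perm ℕ → MvPolynomial ℕ K}
    (hS : IsSchubert y S) {n : ℕ} (hu : InSn n u) (hk : k ≤ n) :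
    S u = ∏ j ∈ Finset.range n, linProd (height k u (j + 1)) (y j) := by
  rw [hS.dominant hu, diagramProd]
  · refine Finset.prod_comm' fun p j => ?_
    simp only [Finset.mem_range]
    rw [h.lt_height_iff]
    have hlt := hu.lt_iff (j := p)
    by_cases hp : p < k
    · rw [h.lehmer_of_lt hu hk hp]
      omega
    · rw [h.lehmer_of_ge n (by omega)]
      omega
  · intro p
    by_cases hp : p + 1 < k
    · rw [h.lehmer_of_lt hu hk hp, h.lehmer_of_lt hu hk (by omega)]
      exact (h.dec p hp).le
    · rw [h.lehmer_of_ge n (by omega)]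
      exact Nat.zero_le _

/-- The structure constants are transfer sums when `u` is decreasing before position `k`. -/
lemma eval_ddPerm_mul (h : DecInc k u) {t y : ℕ → K} {S S' : Equiv.Perm ℕ → MvPolynomial ℕ K}
    (hS : IsSchubert y S) (hS' : IsSchubert t S') {n : ℕ} (hk : k ≤ n) (hu : InSn n u)
    {v w : Equiv.Perm ℕ} (hv : InSn n v) (hvk : IncBelow k v) (hw : InSn n w) :
    eval t (ddPerm w (S u * S' v)) =
      puzZ n (fun i j => t j - y i) (kappaLab k u) (thetaLab k v) n (etaLab w) := by
  have h0 : height k u n = 0 := by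
    by_contra h0
    have h1 := h.lt_height_iff.1 (Nat.pos_of_ne_zero h0)
    have h2 := hu.lt_iff (j := 0)
    omega
  have heta : etaLab w = thetaLab (height k u n) w := by
    funext c
    rw [etaLab, thetaLab, h0, if_pos (Nat.zero_le _)]
  rw [h.schubert_eq hS hu hk, eval_ddPerm_prod_linProd_mul hk h.descendingRight t y hv hvk
    (fun i hi => hS'.dd_eq_zero (hvk i hi)) ((hS'.eval_ddPerm hv.finPerm hv.finPerm).1 rfl)
    (fun w hw hne => (hS'.eval_ddPerm hw.finPerm hv.finPerm).2 hne) n hw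
    (fun i hi => by omega), heta]

end DecInc

end Decreasing

/-! ### Exchanging the labels of two adjacent rows -/

section Exchange

variable {A : Type*} [CommRing A]

lemma LeftOf.not_symm {f : ℕ → ℕ} {j p q : ℕ} (hf : DistinctLabels f j) (hp : 0 < p) (hq : 0 < q)
    (h : LeftOf f j p q) : ¬ LeftOf f j q p := by
  rintro ⟨c, d, h1, h2, h3, h4⟩
  obtain ⟨c', d', h1', h2', h3', h4'⟩ := h
  have e1 := hf c d' (by omega) h2' (by omega) (by omega)
  have e2 := hf d c' h2 (by omega) (by omega) (by omega)
  omega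

lemma sTr_eq_iff {p a b : ℕ} : sTr p a = b ↔ a = sTr p b :=
  ⟨fun h => by rw [← h, sTr_sTr_apply], fun h => by rw [h, sTr_sTr_apply]⟩

lemma leftOf_sTr_iff {f : ℕ → ℕ} {j p : ℕ} :
    LeftOf (fun c => sTr p (f c)) j p (p + 1) ↔ LeftOf f j (p + 1) p := by
  unfold LeftOf
  simp only [sTr_eq_iff, sTr_left, sTr_right]

/-- If pipe `p` enters from the right above pipe `p + 1`, it stays to the left of it. -/
lemma leftOf_of_puzZ_ne_zero {n : ℕ} {τ : ℕ → ℕ → A} {κ θ mu : ℕ → ℕ} {p r : ℕ} (hp : 0 < p)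
    (hθ : ∀ c < n, θ c ≠ p + 1) (hpre : ∀ r, κ r = p + 1 → ∃ r' < r, κ r' = p)
    (h : puzZ n τ κ θ r mu ≠ 0) (hmem : ∃ c < n, mu c = p + 1) : LeftOf mu n p (p + 1) := by
  induction r generalizing mu with
  | zero =>
    rcases (exists_label_iff h (Nat.succ_ne_zero p)).1 hmem with ⟨c, hc, hc'⟩ | ⟨r', hr', -⟩
    · exact absurd hc' (hθ c hc)
    · omega
  | succ r ih =>
    obtain ⟨lam, h1, h2⟩ := exists_of_puzZ_succ_ne_zero h
    refine LeftOf.bottom hp (Nat.lt_succ_self p) h1 ?_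
    rcases (exists_bottom_iff h1 (Nat.succ_ne_zero p)).1 hmem with ha | hlam
    · exact Or.inr ⟨(exists_label_iff h2 hp.ne').2 (Or.inr (hpre r ha)), ha⟩
    · exact Or.inl (ih h2 hlam)

/-- The label exchange `p ↔ p + 1` on rows of labels. -/
def exchangeLabels {n p : ℕ} (hpn : p + 1 ≤ n) : (Fin n → Fin (n + 1)) ≃ (Fin n → Fin (n + 1)) :=
  Equiv.arrowCongr (Equiv.refl _) (Equiv.swap ⟨p, by omega⟩ ⟨p + 1, by omega⟩)

lemma extLab_exchangeLabels {n p : ℕ} (hpn : p + 1 ≤ n) (lam : Fin n → Fin (n + 1)) {c : ℕ}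
    (hc : c < n) : extLab (exchangeLabels hpn lam) c = sTr p (extLab lam c) := by
  rw [extLab, dif_pos hc, extLab, dif_pos hc, sTr_apply]
  simp only [exchangeLabels, Equiv.arrowCongr_apply, Function.comp_apply, Equiv.refl_symm,
    Equiv.refl_apply, Equiv.swap_apply_def, Fin.ext_iff]
  split_ifs <;> rfl

/-- Exchanging the rows in which two adjacent pipes enter. -/
lemma puzZ_exchange {n : ℕ} {τ : ℕ → ℕ → A} {κ θ mu : ℕ → ℕ} {p : ℕ} (hp : 0 < p)
    (hpn : p + 1 ≤ n) (hκ : DistinctBoundary n κ θ) (hθ : ∀ c < n, θ c ≠ p ∧ θ c ≠ p + 1)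
    (hpre : ∀ r, κ r = p + 1 → ∃ r' < r, κ r' = p) (r : ℕ) (hmu : ¬ LeftOf mu n (p + 1) p) :
    puzZ n τ κ θ r mu = puzZ n τ (fun r => sTr p (κ r)) θ r (fun c => sTr p (mu c)) := by
  induction r generalizing mu with
  | zero =>
    rw [puzZ_zero, puzZ_zero]
    congr 1
    refine propext (forall₂_congr fun c hc => ?_)
    rw [sTr_eq_iff, sTr_of_ne (hθ c hc).1 (hθ c hc).2]
  | succ r ih =>
    rw [puzZ_succ, puzZ_succ]
    symm
    rw [← Equiv.sum_comp (exchangeLabels hpn)]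
    refine Finset.sum_congr rfl fun lam _ => Eq.symm ?_
    rw [rowZ_congr (lam := extLab (exchangeLabels hpn lam)) (fun _ _ => rfl)
      (fun c hc => extLab_exchangeLabels hpn lam hc) (fun _ _ => rfl),
      puzZ_congr (mu := extLab (exchangeLabels hpn lam))
        (fun c hc => extLab_exchangeLabels hpn lam hc)]
    by_cases hlam : LeftOf (extLab lam) n (p + 1) p
    · have h1 : puzZ n τ κ θ r (extLab lam) = 0 := by
        by_contra h1
        have ⟨c, d, hcd, hd, hc', _⟩ := hlam
        exact (leftOf_of_puzZ_ne_zero hp (fun c hc => (hθ c hc).2) hpre h1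
          ⟨c, by omega, hc'⟩).not_symm (hκ.distinctLabels h1) hp (by omega) hlam
      have h2 : rowZ (τ r) (fun c => sTr p (extLab lam c)) (fun c => sTr p (mu c)) n
          (sTr p (κ r)) = 0 := by
        by_contra h2
        exact hmu (leftOf_sTr_iff.1 (LeftOf.bottom hp (Nat.lt_succ_self p) h2
          (Or.inl (leftOf_sTr_iff.2 hlam))))
      rw [h1, h2, mul_zero, zero_mul]
    · rw [← ih hlam]
      by_cases h1 : puzZ n τ κ θ r (extLab lam) = 0
      · rw [h1, mul_zero, mul_zero]
      · congr 1
        have := rowZ_exchange (τ := τ r) (lam := fun c => sTr p (extLab lam c))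
          (mu := fun c => sTr p (mu c)) (j := n) (a := sTr p (κ r)) hp
          (fun h => hlam (leftOf_sTr_iff.1 h)) ?_ (fun h => hmu (leftOf_sTr_iff.1 h))
        · simp only [sTr_sTr_apply] at this
          exact this.symm
        · simp only [sTr_eq_iff, sTr_left, sTr_right]
          rintro ⟨hmem, hr⟩
          obtain ⟨c, d, hcd, hd, hc', -⟩ :=
            leftOf_of_puzZ_ne_zero hp (fun c hc => (hθ c hc).2) hpre h1 hmem
          rcases (exists_label_iff h1 hp.ne').1 ⟨c, by omega, hc'⟩ with ⟨e, he, he'⟩ | ⟨r', hr', h'⟩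
          · exact (hθ e he).1 he'
          · have := hκ.right r' r (h'.trans hr.symm) (by omega)
            omega

lemma distinctBoundary_kappaLab_thetaLab (n k : ℕ) (u v : Equiv.Perm ℕ) :
    DistinctBoundary n (kappaLab k u) (thetaLab k v) where
  top c d _ _ hcd h0 := by
    simp only [thetaLab] at hcd h0
    refine v⁻¹.injective ?_
    split_ifs at hcd h0 <;> omega
  right r r' hr h0 := by
    simp only [kappaLab] at hr h0
    refine u⁻¹.injective ?_
    split_ifs at hr h0 <;> omega
  ne r h0 c _ hc := by
    rw [kappaLab] at h0 hc
    rw [thetaLab] at hc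
    split_ifs at h0 hc <;> omega

end Exchange

section Reduction

variable {K : Type*} [Field K]

lemma kappaLab_mul_sTr {k i : ℕ} (hi : i + 1 < k) (u : Equiv.Perm ℕ) :
    kappaLab k (u * sTr i) = fun r => sTr (i + 1) (kappaLab k u r) := by
  funext r
  rw [kappaLab, kappaLab, inv_mul_sTr_apply]
  simp only [sTr_apply]
  split_ifs <;> omega

lemma etaLab_mul_sTr (i : ℕ) (w : Equiv.Perm ℕ) :
    etaLab (w * sTr i) = fun c => sTr (i + 1) (etaLab w c) := by
  funext c
  rw [etaLab, etaLab, inv_mul_sTr_apply]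
  simp only [sTr_apply]
  split_ifs <;> omega

lemma leftOf_etaLab {n p q : ℕ} {w : Equiv.Perm ℕ} (h : LeftOf (etaLab w) n (p + 1) (q + 1)) :
    w p < w q := by
  obtain ⟨c, d, hcd, -, hc, hd⟩ := h
  have e1 : w⁻¹ c = p := Nat.succ_injective hc
  have e2 : w⁻¹ d = q := Nat.succ_injective hd
  rwa [← e1, ← e2, perm_apply_inv_self, perm_apply_inv_self]

/-- The structure constants are transfer sums. -/
lemma eval_ddPerm_mul_eq_puzZ {t y : ℕ → K} {S S' : Equiv.Perm ℕ → MvPolynomial ℕ K}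
    (hS : IsSchubert y S) (hS' : IsSchubert t S') {n k : ℕ} (hk : k ≤ n) {u v w : Equiv.Perm ℕ}
    (hu : InSn n u) (huk : ∀ i, k ≤ i → u i < u (i + 1)) (hv : InSn n v) (hvk : IncBelow k v)
    (hw : InSn n w) :
    eval t (ddPerm w (S u * S' v)) =
      puzZ n (fun i j => t j - y i) (kappaLab k u) (thetaLab k v) n (etaLab w) := by
  induction hm : ∑ j ∈ Finset.range n, j * u j using Nat.strong_induction_on generalizing u w with
  | _ m ih =>
    by_cases hdec : ∀ i, i + 1 < k → u (i + 1) < u i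
    · exact DecInc.eval_ddPerm_mul ⟨hdec, huk⟩ hS hS' hk hu hv hvk hw
    · push Not at hdec
      obtain ⟨i, hi, hasc'⟩ := hdec
      have hasc : u i < u (i + 1) := lt_of_le_of_ne hasc' (perm_apply_ne_succ u i)
      have hin : i + 1 < n := by omega
      have hstep : S u = dd i (S (u * sTr i)) := by
        rw [← hS.step (u * sTr i) i (by
          rwa [Equiv.Perm.mul_apply, Equiv.Perm.mul_apply, sTr_right, sTr_left]), mul_sTr_cancel]
      have hdd : S u * S' v = dd i (S (u * sTr i) * S' v) := by
        rw [mul_comm (S (u * sTr i)), dd_mul_of_dd_left_eq_zero _ (hS'.dd_eq_zero (hvk i hi)),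
          hstep, mul_comm]
      have hθ : ∀ c < n, thetaLab k v c ≠ i + 1 ∧ thetaLab k v c ≠ i + 1 + 1 := fun c _ => by
        rw [thetaLab]
        split_ifs <;> omega
      have hpre : ∀ r, kappaLab k u r = i + 1 + 1 → ∃ r' < r, kappaLab k u r' = i + 1 := by
        intro r hr
        rw [kappaLab] at hr
        have hr' : u⁻¹ r = i + 1 := by
          split_ifs at hr
          omega
        refine ⟨u i, ?_, ?_⟩
        · rwa [← perm_apply_inv_self u r, hr']
        · rw [kappaLab, perm_inv_apply_self, if_pos (by omega)]
      rw [hdd]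
      rcases lt_or_gt_of_ne (perm_apply_ne_succ w i) with h | h
      · rw [← ddPerm_mul_sTr hw.finPerm h, ih _ ?_ (hu.mul (inSn_sTr hin)) ?_
          (hw.mul (inSn_sTr hin)) rfl, kappaLab_mul_sTr hi, etaLab_mul_sTr]
        · refine (puzZ_exchange (Nat.succ_pos i) hin (distinctBoundary_kappaLab_thetaLab n k u v)
            hθ hpre n fun h' => ?_).symm
          have := leftOf_etaLab h'
          omega
        · rw [← hm]
          exact sum_comp_sTr_lt_of_ascent hin hasc
        · intro j hj
          rw [Equiv.Perm.mul_apply, Equiv.Perm.mul_apply, sTr_of_ne (by omega) (by omega),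
            sTr_of_ne (by omega) (by omega)]
          exact huk j hj
      · rw [ddPerm_eq_zero hw.finPerm h (dd_dd i _), map_zero]
        by_contra h0
        have := leftOf_etaLab (leftOf_of_puzZ_ne_zero (Nat.succ_pos i) (fun c hc => (hθ c hc).2)
          hpre (Ne.symm h0) ⟨w (i + 1), hw.lt_iff.2 hin, by rw [etaLab, perm_inv_apply_self]⟩)
        omega

end Reduction

/-! ### Pipe puzzles and transfer sums -/

section Paths

variable {A : Type*} [CommRing A]

/-- The weighted count of paths with `j` steps ending in a given state, with transition weights
`T` and initial weights `g`. -/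
def pathZ {σ : Type*} [Fintype σ] (T : ℕ → σ → σ → A) (g : σ → A) : ℕ → σ → A
  | 0, b => g b
  | j + 1, b => ∑ a, T j a b * pathZ T g j a

lemma sum_paths {σ : Type*} [Fintype σ] (T : ℕ → σ → σ → A) (g G : σ → A) (j : ℕ) :
    ∑ h : Fin (j + 1) → σ, g (h 0) * (∏ c : Fin j, T c (h c.castSucc) (h c.succ)) *
      G (h (Fin.last j)) = ∑ b, pathZ T g j b * G b := by
  induction j generalizing G with
  | zero =>
    rw [← Equiv.sum_comp (Equiv.funUnique (Fin 1) σ)]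
    refine Finset.sum_congr rfl fun h _ => ?_
    rw [Finset.univ_eq_empty, Finset.prod_empty, mul_one]
    rfl
  | succ j ih =>
    rw [← Equiv.sum_comp (Fin.snocEquiv fun _ => σ), Fintype.sum_prod_type]
    refine Finset.sum_congr rfl fun b _ => ?_
    rw [pathZ, Finset.sum_mul]
    have := ih fun a => T j a b * G b
    rw [Finset.sum_congr rfl fun a _ =>
      (show T j a b * pathZ T g j a * G b = pathZ T g j a * (T j a b * G b) by ring), ← this]
    refine Finset.sum_congr rfl fun h _ => ?_
    simp only [Fin.snocEquiv_apply, Fin.prod_univ_castSucc, Fin.succ_castSucc, Fin.succ_last,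
      Fin.snoc_castSucc, Fin.snoc_last, Fin.val_castSucc, Fin.val_last]
    rw [← Fin.castSucc_zero, Fin.snoc_castSucc]
    ring

open Classical in
/-- The weight of a tile of a Schubert pipe puzzle in terms of its four labels. -/
def tileWt (x : A) (N E W S : ℕ) : A :=
  if LAdm0 N E W S then if N = 0 ∧ E = 0 ∧ W = 0 ∧ S = 0 then x else 1 else 0

lemma tileWt_eq (x : A) (N E W S : ℕ) :
    tileWt x N E W S = if W = N + E - S then tile x N E S else 0 := by
  unfold tileWt tile LAdm0
  split_ifs <;> first | rfl | (exfalso; omega)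

/-- A row of a pipe puzzle, summed over its horizontal labels. -/
lemma sum_row_eq_rowZ {n : ℕ} (τ : ℕ → A) {lam mu : ℕ → ℕ} (hlam : ∀ c < n, lam c ≤ n) {a : ℕ}
    (ha : a ≤ n) :
    ∑ h : Fin (n + 1) → Fin (n + 1), (if (h 0 : ℕ) = 0 then 1 else 0) *
      (∏ c : Fin n, tileWt (τ c) (lam c) (h c.succ) (h c.castSucc) (mu c)) *
      (if (h (Fin.last n) : ℕ) = a then 1 else 0) = rowZ τ lam mu n a := by
  rw [sum_paths (fun c (x y : Fin (n + 1)) => tileWt (τ c) (lam c) y x (mu c))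
    (fun x => if (x : ℕ) = 0 then 1 else 0) (fun x => if (x : ℕ) = a then 1 else 0)]
  have key : ∀ j ≤ n, ∀ b : Fin (n + 1),
      pathZ (fun c (x y : Fin (n + 1)) => tileWt (τ c) (lam c) y x (mu c))
        (fun x => if (x : ℕ) = 0 then 1 else 0) j b = rowZ τ lam mu j b := by
    intro j hj
    induction j with
    | zero => exact fun b => rfl
    | succ j ih =>
      intro b
      rw [pathZ, rowZ_succ]
      by_cases h0 : tile (τ j) (lam j) b (mu j) = 0
      · rw [h0, zero_mul]
        refine Finset.sum_eq_zero fun x _ => ?_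
        rw [tileWt_eq, h0, ite_self, zero_mul]
      · have h1 := hlam j (by omega)
        have hlt : lam j + b - mu j < n + 1 := by
          have := b.2
          rcases tile_ne_zero h0 with h | h | h | h | h | h <;> omega
        rw [Finset.sum_eq_single ⟨lam j + b - mu j, hlt⟩]
        · rw [tileWt_eq, if_pos rfl, ih (by omega)]
        · intro x _ hx
          rw [tileWt_eq, if_neg (fun e => hx (Fin.ext e)), zero_mul]
        · exact fun h => absurd (Finset.mem_univ _) h
  rw [Finset.sum_eq_single ⟨a, by omega⟩]
  · rw [key n le_rfl, if_pos rfl, mul_one]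
  · intro x _ hx
    rw [if_neg (fun e => hx (Fin.ext e)), mul_zero]
  · exact fun h => absurd (Finset.mem_univ _) h

/-- A grid of rows, summed over its vertical labels. -/
lemma sum_rows_eq_puzZ {n : ℕ} (τ : ℕ → ℕ → A) (κ θ : ℕ → ℕ) {mu : ℕ → ℕ}
    (hmu : ∀ c < n, mu c ≤ n) :
    ∑ V : Fin (n + 1) → Fin n → Fin (n + 1),
      (if ∀ j, (V 0 j : ℕ) = θ j then 1 else 0) *
      (∏ i : Fin n, rowZ (τ i) (extLab (V i.castSucc)) (extLab (V i.succ)) n (κ i)) *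
      (if ∀ j, (V (Fin.last n) j : ℕ) = mu j then 1 else 0) = puzZ n τ κ θ n mu := by
  rw [sum_paths (fun i (x y : Fin n → Fin (n + 1)) => rowZ (τ i) (extLab x) (extLab y) n (κ i))
    (fun x => if ∀ j, (x j : ℕ) = θ j then 1 else 0)
    (fun x => if ∀ j, (x j : ℕ) = mu j then 1 else 0)]
  have key : ∀ (r : ℕ) (b : Fin n → Fin (n + 1)),
      pathZ (fun i (x y : Fin n → Fin (n + 1)) => rowZ (τ i) (extLab x) (extLab y) n (κ i))
        (fun x => if ∀ j, (x j : ℕ) = θ j then 1 else 0) r b = puzZ n τ κ θ r (extLab b) := by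
    intro r
    induction r with
    | zero =>
      intro b
      rw [pathZ, puzZ_zero]
      refine if_congr ⟨fun h c hc => ?_, fun h j => ?_⟩ rfl rfl
      · rw [← h ⟨c, hc⟩, extLab, dif_pos hc]
      · rw [← h j j.2, extLab_val]
    | succ r ih =>
      intro b
      rw [pathZ, puzZ_succ]
      exact Finset.sum_congr rfl fun x _ => by rw [ih]
  rw [Finset.sum_eq_single fun j => ⟨mu j, Nat.lt_succ_of_le (hmu j j.2)⟩]
  · rw [key, if_pos (fun _ => rfl), mul_one]
    refine puzZ_congr (fun c hc => ?_) n
    rw [extLab, dif_pos hc]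
  · intro x _ hx
    rw [if_neg (fun e => hx (funext fun j => Fin.ext (e j))), mul_zero]
  · exact fun h => absurd (Finset.mem_univ _) h

end Paths

section Puzzles

variable {K : Type*} [Field K]

open Classical in
lemma stateWt0_indicator (n k : ℕ) (u v w : Equiv.Perm ℕ) (t y : ℕ → K)
    (H : Fin n → Fin (n + 1) → Fin (n + 1)) (V : Fin (n + 1) → Fin n → Fin (n + 1)) :
    (if (H, V) ∈ PP0 n k u v w then stateWt0 t y (H, V) else 0) =
      (if ∀ j, (V 0 j : ℕ) = thetaLab k v j then 1 else 0) *
      (∏ i : Fin n, ((if (H i 0 : ℕ) = 0 then 1 else 0) *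
        (∏ j : Fin n, tileWt (t j - y i) (extLab (V i.castSucc) j) (H i j.succ)
          (H i j.castSucc) (extLab (V i.succ) j)) *
        (if (H i (Fin.last n) : ℕ) = kappaLab k u i then 1 else 0))) *
      (if ∀ j, (V (Fin.last n) j : ℕ) = etaLab w j then 1 else 0) := by
  simp only [extLab_val, tileWt, Finset.prod_ite_zero, ite_zero_mul_ite_zero, one_mul, mul_one]
  refine if_congr ?_ rfl rfl
  simp only [PP0, BoundaryCond, Set.mem_ofPred_eq, Finset.mem_univ, forall_const, forall_and,
    labN, labE, labW, labS]
  tauto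

/-- The weighted count of Schubert pipe puzzles is a transfer sum. -/
lemma finsum_stateWt0_eq_puzZ {n k : ℕ} (hk : k ≤ n) {u v w : Equiv.Perm ℕ} (hw : InSn n w)
    (t y : ℕ → K) :
    ∑ᶠ π ∈ PP0 n k u v w, stateWt0 t y π =
      puzZ n (fun i j => t j - y i) (kappaLab k u) (thetaLab k v) n (etaLab w) := by
  classical
  rw [finsum_mem_def, finsum_eq_sum_of_fintype]
  simp only [Set.indicator_apply, Fintype.sum_prod_type_right, stateWt0_indicator]
  rw [← sum_rows_eq_puzZ (mu := etaLab w) _ _ _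
    fun c hc => hw.inv.lt_iff.2 hc]
  refine Finset.sum_congr rfl fun V _ => ?_
  rw [← Finset.sum_mul, ← Finset.mul_sum]
  congr 2
  have hκ : ∀ i, kappaLab k u i ≤ n := fun i => by
    rw [kappaLab]
    split_ifs <;> omega
  rw [Finset.prod_congr rfl fun (i : Fin n) _ => (sum_row_eq_rowZ (fun j => t j - y i)
    (lam := extLab (V i.castSucc)) (mu := extLab (V i.succ)) (fun c hc => by
      rw [extLab, dif_pos hc]
      exact Nat.le_of_lt_succ (V i.castSucc ⟨c, hc⟩).2) (hκ i)).symm,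
    Finset.prod_univ_sum, Fintype.piFinset_univ]

end Puzzles

/-- Theorem `HHUU` of the paper.  Let `u, v ∈ S_n` have
separated descents at position `k` and let `w ∈ S_n`.  Then the double Schubert
structure constant `c̄_{u,v}^w(t, y)` equals the sum of the Schubert weights of
all Schubert pipe puzzles for `(u, v, w)`.  (Double Schubert polynomials are the
`β = 0` specialization of double Grothendieck polynomials.) -/
theorem schubert_structure_constant_eq_schubert_pipe_puzzle_sum
    {K : Type*} [Field K]
    (S : (ℕ → K) → Equiv.Perm ℕ → MvPolynomial ℕ K)
    (cbar : (ℕ → K) → (ℕ → K) → Equiv.Perm ℕ → Equiv.Perm ℕ → Equiv.Perm ℕ → K)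
    (hS : GrothFamily (0 : K) S) (hc : StructConsts (0 : K) S cbar)
    (n k : ℕ) (hk : k ≤ n)
    (u v w : Equiv.Perm ℕ) (hu : InSn n u) (hv : InSn n v) (hw : InSn n w)
    (hsep : SepDesc k u v)
    (t y : ℕ → K) :
    cbar t y u v w = ∑ᶠ π ∈ PP0 n k u v w, stateWt0 t y π := by
  rw [hc.eq_eval_ddPerm hS t y hu.finPerm hv.finPerm hw.finPerm,
    eval_ddPerm_mul_eq_puzZ (hS.isSchubert y) (hS.isSchubert t) hk hu
      (fun i hi => lt_of_le_of_ne (hsep.1 i hi) (perm_apply_ne_succ u i)) hv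
      (fun i hi => lt_of_le_of_ne (hsep.2 i hi) (perm_apply_ne_succ v i)) hw,
    finsum_stateWt0_eq_puzZ hk hw]
end BPDPuzzle
end
end

section
/- Yang–Baxter equation for R_row: for all labels a_1,a_2,a_3,b_1,b_2,b_3 ∈ {0,1,…,n} and parameters x,y, one has Σ_{c_1,c_2,c_3∈{0,…,n}} R_row(x⊖y; b_1,b_2,c_1,c_2)·L(x; a_1,a_2,c_1,c_3)·L(y; c_3,a_3,c_2,b_3) = Σ_{d_1,d_2,d_3∈{0,…,n}} L(y; a_1,d_1,b_1,d_3)·L(x; d_3,d_2,b_2,b_3)·R_row(x⊖y; d_1,d_2,a_2,a_3), as identities of rational functions in x, y and β. -/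
open MvPolynomial

noncomputable section

namespace BPDPuzzle

/-- The `R`-matrix weight `R_row(x; NW, SW, NE, SE)`. -/
def Rrow {K : Type*} [Field K] (β : K) (k : ℕ) (x : K) (NW SW NE SE : ℕ) : K :=
  if NW = SW ∧ SW = NE ∧ NE = SE then 1
  else if SW = 0 ∧ SE = 0 ∧ 0 < NW ∧ NW = NE ∧ NE ≤ k then 1
  else if NW = 0 ∧ NE = 0 ∧ k < SW ∧ SW = SE then 1
  else if 0 < NW ∧ NW = NE ∧ NW < SW ∧ SW = SE then 1
  else if SW = 0 ∧ NE = 0 ∧ 0 < NW ∧ NW = SE then x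
  else if NW = SE ∧ 0 < NW ∧ NW < SW ∧ SW = NE then x
  else if NW = 0 ∧ NE = 0 ∧ 0 < SW ∧ SW = SE ∧ SE ≤ k then 1 + β * x
  else if SW = 0 ∧ SE = 0 ∧ k < NW ∧ NW = NE then 1 + β * x
  else if 0 < SW ∧ SW = SE ∧ SW < NW ∧ NW = NE then 1 + β * x
  else 0

/-- The Kronecker delta on labels. -/
def delta (K : Type*) [Field K] (i j : ℕ) : K := if i = j then 1 else 0

/-- The weight of a vertex at which both labels continue straight. -/
def straightWt {K : Type*} [Field K] (x : K) (N E : ℕ) : K :=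
  if N = 0 then (if E = 0 then x else 1) else if E < N then 1 else 0

/-- The weight of a vertex at which two distinct labels turn. -/
def turnWt {K : Type*} [Field K] (β : K) (k : ℕ) (x : K) (N E : ℕ) : K :=
  if N = E then 0
  else if E = 0 then (if N ≤ k then 1 + β * x else 1)
  else if N = 0 then (if E ≤ k then 1 else 1 + β * x)
  else if E < N then (if N ≤ k then β else if k < E then β else 0)
  else if N ≤ k then (if k < E then β * (1 + β * x) else 0) else 0

/-- The `R_row` weight when the labels `u` (upper) and `l` (lower) do not cross. -/
def parallelWt {K : Type*} [Field K] (β : K) (k : ℕ) (z : K) (u l : ℕ) : K :=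
  if u = l then 1
  else if l = 0 then (if u ≤ k then 1 else 1 + β * z)
  else if u = 0 then (if k < l then 1 else 1 + β * z)
  else if u < l then 1 else 1 + β * z

/-- The `R_row` weight when two distinct labels cross, ending at `u` (upper) and `l` (lower). -/
def crossWt {K : Type*} [Field K] (z : K) (u l : ℕ) : K :=
  if u = l then 0
  else if u = 0 then z
  else if l = 0 then 0
  else if l < u then z else 0

theorem Lwt_eq {K : Type*} [Field K] (β : K) (k : ℕ) (x : K) (N E W S : ℕ) :
    Lwt β k x N E W S = delta K W E * (delta K S N * straightWt x N E) +
      delta K W N * (delta K S E * turnWt β k x N E) := by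
  unfold Lwt delta straightWt turnWt
  grind (splits := 40)

theorem Rrow_eq {K : Type*} [Field K] (β : K) (k : ℕ) (z : K) (NW SW NE SE : ℕ) :
    Rrow β k z NW SW NE SE =
      delta K NW NE * (delta K SW SE * parallelWt β k z NE SE) +
      delta K NW SE * (delta K SW NE * crossWt z NE SE) := by
  unfold Rrow delta parallelWt crossWt
  grind (splits := 40)

theorem sum_delta_mul {K : Type*} [Field K] {n a : ℕ} (ha : a ≤ n) (h : ℕ → K) :
    ∑ i ∈ Finset.range (n + 1), delta K i a * h i = h a := by
  simp [delta, Finset.sum_ite_eq', Nat.lt_succ_of_le ha]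

/-- Summing a function against a vertex weight over its west label. -/
theorem sum_Lwt_west {K : Type*} [Field K] (β : K) (k : ℕ) (x : K) {n N E : ℕ}
    (hN : N ≤ n) (hE : E ≤ n) (S : ℕ) (h : ℕ → K) :
    ∑ W ∈ Finset.range (n + 1), Lwt β k x N E W S * h W =
      delta K S N * straightWt x N E * h E + delta K S E * turnWt β k x N E * h N := by
  simp only [Lwt_eq, add_mul, mul_assoc, Finset.sum_add_distrib, sum_delta_mul, hN, hE]

/-- Summing a function against a vertex weight over its south label. -/
theorem sum_Lwt_south {K : Type*} [Field K] (β : K) (k : ℕ) (x : K) {n N E : ℕ}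
    (hN : N ≤ n) (hE : E ≤ n) (W : ℕ) (h : ℕ → K) :
    ∑ S ∈ Finset.range (n + 1), Lwt β k x N E W S * h S =
      delta K W E * straightWt x N E * h N + delta K W N * turnWt β k x N E * h E := by
  simp only [Lwt_eq, add_mul, mul_assoc, mul_left_comm (delta K W _), Finset.sum_add_distrib,
    sum_delta_mul, hN, hE]

/-- Summing a function against a vertex weight over its west and south labels. -/
theorem sum_Lwt_west_south {K : Type*} [Field K] (β : K) (k : ℕ) (x : K) {n N E : ℕ}
    (hN : N ≤ n) (hE : E ≤ n) (h : ℕ → ℕ → K) :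
    ∑ W ∈ Finset.range (n + 1), ∑ S ∈ Finset.range (n + 1), Lwt β k x N E W S * h W S =
      straightWt x N E * h E N + turnWt β k x N E * h N E := by
  simp only [sum_Lwt_south β k x hN hE, mul_assoc, Finset.sum_add_distrib, sum_delta_mul, hN, hE]

/-- Summing a function against an `R_row` weight over its west labels. -/
theorem sum_Rrow_west {K : Type*} [Field K] (β : K) (k : ℕ) (z : K) {n u l : ℕ}
    (hu : u ≤ n) (hl : l ≤ n) (h : ℕ → ℕ → K) :
    ∑ i ∈ Finset.range (n + 1), ∑ j ∈ Finset.range (n + 1), Rrow β k z i j u l * h i j =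
      parallelWt β k z u l * h u l + crossWt z u l * h l u := by
  simp only [Rrow_eq, add_mul, mul_assoc, Finset.sum_add_distrib, ← Finset.mul_sum,
    sum_delta_mul, hu, hl]

/-- The left-hand side of the Yang–Baxter equation, summed over the internal labels. -/
theorem sum_Rrow_Lwt_Lwt {K : Type*} [Field K] (β : K) (k : ℕ) (x y z : K)
    {n a1 a2 a3 : ℕ} (ha1 : a1 ≤ n) (ha2 : a2 ≤ n) (ha3 : a3 ≤ n) (b1 b2 b3 : ℕ) :
    (∑ c1 ∈ Finset.range (n + 1), ∑ c2 ∈ Finset.range (n + 1), ∑ c3 ∈ Finset.range (n + 1),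
        Rrow β k z b1 b2 c1 c2 * Lwt β k x a1 a2 c1 c3 * Lwt β k y c3 a3 c2 b3) =
      straightWt x a1 a2 *
        (delta K b3 a1 * straightWt y a1 a3 * Rrow β k z b1 b2 a2 a3 +
          delta K b3 a3 * turnWt β k y a1 a3 * Rrow β k z b1 b2 a2 a1) +
      turnWt β k x a1 a2 *
        (delta K b3 a2 * straightWt y a2 a3 * Rrow β k z b1 b2 a1 a3 +
          delta K b3 a3 * turnWt β k y a2 a3 * Rrow β k z b1 b2 a1 a2) := by
  rw [← sum_Lwt_west β k y ha1 ha3, ← sum_Lwt_west β k y ha2 ha3,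
    ← sum_Lwt_west_south β k x ha1 ha2 fun c1 c3 =>
      ∑ c2 ∈ Finset.range (n + 1), Lwt β k y c3 a3 c2 b3 * Rrow β k z b1 b2 c1 c2]
  refine Finset.sum_congr rfl fun c1 _ => ?_
  rw [Finset.sum_comm]
  refine Finset.sum_congr rfl fun c3 _ => ?_
  rw [Finset.mul_sum]
  exact Finset.sum_congr rfl fun c2 _ => by ring

/-- The right-hand side of the Yang–Baxter equation, summed over the internal labels. -/
theorem sum_Lwt_Lwt_Rrow {K : Type*} [Field K] (β : K) (k : ℕ) (x y z : K)
    {n a1 a2 a3 : ℕ} (ha1 : a1 ≤ n) (ha2 : a2 ≤ n) (ha3 : a3 ≤ n) (b1 b2 b3 : ℕ) :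
    (∑ d1 ∈ Finset.range (n + 1), ∑ d2 ∈ Finset.range (n + 1), ∑ d3 ∈ Finset.range (n + 1),
        Lwt β k y a1 d1 b1 d3 * Lwt β k x d3 d2 b2 b3 * Rrow β k z d1 d2 a2 a3) =
      parallelWt β k z a2 a3 *
        (delta K b1 a2 * straightWt y a1 a2 * Lwt β k x a1 a3 b2 b3 +
          delta K b1 a1 * turnWt β k y a1 a2 * Lwt β k x a2 a3 b2 b3) +
      crossWt z a2 a3 *
        (delta K b1 a3 * straightWt y a1 a3 * Lwt β k x a1 a2 b2 b3 +
          delta K b1 a1 * turnWt β k y a1 a3 * Lwt β k x a3 a2 b2 b3) := by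
  rw [← sum_Lwt_south β k y ha1 ha2 b1 fun d3 => Lwt β k x d3 a3 b2 b3,
    ← sum_Lwt_south β k y ha1 ha3 b1 fun d3 => Lwt β k x d3 a2 b2 b3,
    ← sum_Rrow_west β k z ha2 ha3 fun d1 d2 =>
      ∑ d3 ∈ Finset.range (n + 1), Lwt β k y a1 d1 b1 d3 * Lwt β k x d3 d2 b2 b3]
  refine Finset.sum_congr rfl fun d1 _ => Finset.sum_congr rfl fun d2 _ => ?_
  rw [← Finset.sum_mul, mul_comm]

set_option maxHeartbeats 4000000 in
/-- The Yang–Baxter equation after summation over the internal labels, for the spectral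
parameters `y`, `z` and `y ⊕ z = y + z + βyz`. -/
theorem yang_baxter_collapsed {K : Type*} [Field K] (β : K) (k : ℕ) (y z : K)
    (a1 a2 a3 b1 b2 b3 : ℕ) :
    straightWt (y + z + β * y * z) a1 a2 *
        (delta K b3 a1 * straightWt y a1 a3 * Rrow β k z b1 b2 a2 a3 +
          delta K b3 a3 * turnWt β k y a1 a3 * Rrow β k z b1 b2 a2 a1) +
      turnWt β k (y + z + β * y * z) a1 a2 *
        (delta K b3 a2 * straightWt y a2 a3 * Rrow β k z b1 b2 a1 a3 +
          delta K b3 a3 * turnWt β k y a2 a3 * Rrow β k z b1 b2 a1 a2) =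
    parallelWt β k z a2 a3 *
        (delta K b1 a2 * straightWt y a1 a2 * Lwt β k (y + z + β * y * z) a1 a3 b2 b3 +
          delta K b1 a1 * turnWt β k y a1 a2 * Lwt β k (y + z + β * y * z) a2 a3 b2 b3) +
      crossWt z a2 a3 *
        (delta K b1 a3 * straightWt y a1 a3 * Lwt β k (y + z + β * y * z) a1 a2 b2 b3 +
          delta K b1 a1 * turnWt β k y a1 a3 * Lwt β k (y + z + β * y * z) a3 a2 b2 b3) := by
  simp only [Lwt_eq, Rrow_eq]
  have range_of_label (a : ℕ) : a = 0 ∨ (0 < a ∧ a ≤ k) ∨ (0 < a ∧ k < a) := by omega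
  rcases range_of_label a1 with h1 | h1 | h1 <;> rcases range_of_label a2 with h2 | h2 | h2 <;>
    rcases range_of_label a3 with h3 | h3 | h3 <;>
    rcases lt_trichotomy a1 a2 with h12 | h12 | h12 <;> try (exfalso; omega)
  all_goals
    rcases lt_trichotomy a1 a3 with h13 | h13 | h13 <;>
      rcases lt_trichotomy a2 a3 with h23 | h23 | h23 <;> try (exfalso; omega)
  all_goals
    try subst h12
    try subst h13
    try subst h23
    try subst h1
    try subst h2
    try subst h3
    simp only [straightWt, turnWt, parallelWt, crossWt]
    simp (disch := omega) only [if_pos, if_neg, if_true]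
    ring

theorem eq_oplus_ominus {K : Type*} [Field K] {β x y : K} (hden : 1 + β * y ≠ 0) :
    x = y + ominus β x y + β * y * ominus β x y := by
  unfold ominus
  linear_combination -div_mul_cancel₀ (x - y) hden

/-- Theorem `thm:YBE-1` of the paper: the Yang–Baxter equation
for the `R`-matrix `R_row`. -/
theorem yang_baxter_row
    {K : Type*} [Field K] (β : K) (n k : ℕ) (hk : k ≤ n)
    (x y : K) (hden : 1 + β * y ≠ 0)
    (a1 a2 a3 b1 b2 b3 : ℕ)
    (ha1 : a1 ≤ n) (ha2 : a2 ≤ n) (ha3 : a3 ≤ n)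
    (hb1 : b1 ≤ n) (hb2 : b2 ≤ n) (hb3 : b3 ≤ n) :
    (∑ c1 ∈ Finset.range (n + 1), ∑ c2 ∈ Finset.range (n + 1),
      ∑ c3 ∈ Finset.range (n + 1),
        Rrow β k (ominus β x y) b1 b2 c1 c2 * Lwt β k x a1 a2 c1 c3 *
          Lwt β k y c3 a3 c2 b3) =
    ∑ d1 ∈ Finset.range (n + 1), ∑ d2 ∈ Finset.range (n + 1),
      ∑ d3 ∈ Finset.range (n + 1),
        Lwt β k y a1 d1 b1 d3 * Lwt β k x d3 d2 b2 b3 *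
          Rrow β k (ominus β x y) d1 d2 a2 a3 := by
  rw [sum_Rrow_Lwt_Lwt β k x y _ ha1 ha2 ha3, sum_Lwt_Lwt_Rrow β k x y _ ha1 ha2 ha3]
  have collapsed := yang_baxter_collapsed β k y (ominus β x y) a1 a2 a3 b1 b2 b3
  rwa [← eq_oplus_ominus hden] at collapsed
end BPDPuzzle
end
end
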